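/- arXiv:1508.00791 — 3 statements merged into one kernel-verified Lean document; each statement's English description precedes it below -/
import Mathlib

section
/- Let m ≥ 2, 0 ≤ α < 1, 0 ≤ β < 1, and suppose 1 ≪ μ^m ≪ λ. Then the oscillatory integral ∫₀¹ e^{i(μξ − λξ^m)} ξ^{−α} |log(ξ/2)|^{−β} dξ satisfies the lower bound |∫₀¹ e^{i(μξ−λξ^m)} ξ^{−α}|log(ξ/2)|^{−β} dξ| ≳ λ^{(α−1)/m} (log λ)^{−β}, where the implicit constant depends only on m, α, β. -/
open intervalIntegral

theorem norm_integral_exp_mul_le {ψ D h h' B : ℝ → ℝ} {a b : ℝ} (hab : a ≤ b)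
    (hψ : ∀ x ∈ Set.Icc a b, HasDerivAt ψ (-D x) x)
    (hh : ∀ x ∈ Set.Icc a b, HasDerivAt h (h' x) x)
    (hD : ContinuousOn D (Set.Icc a b)) (hh' : ContinuousOn h' (Set.Icc a b))
    (hB : ContinuousOn B (Set.Icc a b)) (hle : ∀ x ∈ Set.Icc a b, |h' x| ≤ B x) :
    ‖∫ x in a..b, Complex.exp (Complex.I * (ψ x : ℂ)) * ((D x * h x : ℝ) : ℂ)‖ ≤
      |h a| + |h b| + ∫ x in a..b, B x := by
  have hψc : ContinuousOn ψ (Set.Icc a b) := fun x hx => (hψ x hx).continuousAt.continuousWithinAt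
  have hhc : ContinuousOn h (Set.Icc a b) := fun x hx => (hh x hx).continuousAt.continuousWithinAt
  set e : ℝ → ℂ := fun x => Complex.exp (Complex.I * (ψ x : ℂ)) with he
  have hec : ContinuousOn e (Set.Icc a b) :=
    (continuousOn_const.mul (Complex.continuous_ofReal.comp_continuousOn hψc)).cexp
  have hen : ∀ x, ‖e x‖ = 1 := fun x => Complex.norm_exp_I_mul_ofReal _
  have hcc : ∀ {f : ℝ → ℝ}, ContinuousOn f (Set.Icc a b) →
      ContinuousOn (fun x => (f x : ℂ)) (Set.Icc a b) := fun hf =>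
    Complex.continuous_ofReal.comp_continuousOn hf
  have hi : ∀ {E : Type} [NormedAddCommGroup E] {f : ℝ → E}, ContinuousOn f (Set.Icc a b) →
      IntervalIntegrable f MeasureTheory.volume a b := fun hf =>
    ContinuousOn.intervalIntegrable_of_Icc hab hf
  have h1 : IntervalIntegrable (fun x => e x * ((D x * h x : ℝ) : ℂ)) MeasureTheory.volume a b :=
    hi (hec.mul (hcc (hD.mul hhc)))
  have h2 : IntervalIntegrable (fun x => e x * (h' x : ℂ)) MeasureTheory.volume a b :=
    hi (hec.mul (hcc hh'))
  have hder : ∀ x ∈ Set.uIcc a b, HasDerivAt (fun x => Complex.I * (e x * (h x : ℂ)))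
      (e x * ((D x * h x : ℝ) : ℂ) + Complex.I * (e x * (h' x : ℂ))) x := by
    intro x hx
    rw [Set.uIcc_of_le hab] at hx
    have hex : HasDerivAt e (e x * (Complex.I * ((-D x : ℝ) : ℂ))) x :=
      ((hψ x hx).ofReal_comp.const_mul Complex.I).cexp
    refine ((hex.mul (hh x hx).ofReal_comp).const_mul Complex.I).congr_deriv ?_
    push_cast
    linear_combination (-e x * D x * h x) * Complex.I_mul_I
  have key := intervalIntegral.integral_eq_sub_of_hasDerivAt hder (h1.add (h2.const_mul _))
  rw [intervalIntegral.integral_add h1 (h2.const_mul _), intervalIntegral.integral_const_mul] at key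
  have hbd : ‖∫ x in a..b, e x * (h' x : ℂ)‖ ≤ ∫ x in a..b, B x := by
    refine intervalIntegral.norm_integral_le_of_norm_le hab ?_ (hi hB)
    filter_upwards with x hx
    rw [norm_mul, hen, one_mul, Complex.norm_real]
    exact hle x (Set.Ioc_subset_Icc_self hx)
  rw [eq_sub_of_add_eq key]
  refine (norm_sub_le _ _).trans ?_
  have h3 : ‖Complex.I * (e b * (h b : ℂ)) - Complex.I * (e a * (h a : ℂ))‖ ≤ |h a| + |h b| := by
    refine (norm_sub_le _ _).trans ?_
    simp [hen, add_comm]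
  have h4 : ‖Complex.I * ∫ x in a..b, e x * (h' x : ℂ)‖ ≤ ∫ x in a..b, B x := by
    simpa using hbd
  linarith

theorem sub_le_integral_sin_rpow {m α A : ℝ} (hm : 2 ≤ m) (hα : 0 ≤ α) (hA : 1 ≤ A) :
    -((1 - Real.cos 1) / m) ≤ ∫ x in (1 : ℝ)..A, Real.sin (x ^ m) * x ^ (-α) := by
  have hm0 : 0 < m := by linarith
  have hpos : ∀ x ∈ Set.Icc 1 A, 0 < x := fun x hx => by linarith [hx.1]
  have hd : ∀ x ∈ Set.Icc 1 A, HasDerivAt (fun x : ℝ => (1 - Real.cos (x ^ m)) * x ^ (1 - m - α) / m)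
      (Real.sin (x ^ m) * x ^ (-α) -
        (1 - Real.cos (x ^ m)) * ((m - 1 + α) / m * x ^ (1 - m - α - 1))) x := by
    intro x hx
    have hx0 := hpos x hx
    have h1 : HasDerivAt (fun x : ℝ => x ^ m) (m * x ^ (m - 1)) x :=
      Real.hasDerivAt_rpow_const (Or.inl hx0.ne')
    have h2 : HasDerivAt (fun x : ℝ => x ^ (1 - m - α)) ((1 - m - α) * x ^ (1 - m - α - 1)) x :=
      Real.hasDerivAt_rpow_const (Or.inl hx0.ne')
    refine (((h1.cos.const_sub 1).mul h2).div_const m).congr_deriv ?_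
    have h3 : x ^ (-α) = x ^ (m - 1) * x ^ (1 - m - α) := by
      rw [← Real.rpow_add hx0]; ring_nf
    rw [h3]
    field_simp
    ring
  have hc : ContinuousOn (fun x : ℝ => Real.sin (x ^ m) * x ^ (-α)) (Set.Icc 1 A) := by
    refine (Real.continuous_sin.comp_continuousOn
      (continuousOn_id.rpow_const fun x hx => Or.inl (hpos x hx).ne')).mul
      (continuousOn_id.rpow_const fun x hx => Or.inl (hpos x hx).ne')
  have key := intervalIntegral.sub_le_integral_of_hasDeriv_right_of_le hA
    (fun x hx => (hd x hx).continuousAt.continuousWithinAt)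
    (fun x hx => (hd x (Set.Ioo_subset_Icc_self hx)).hasDerivWithinAt)
    (hc.integrableOn_Icc) (fun x hx => by
      have hx0 := hpos x (Set.Ioo_subset_Icc_self hx)
      have : 0 ≤ 1 - Real.cos (x ^ m) := by linarith [Real.cos_le_one (x ^ m)]
      have h4 : 0 ≤ m - 1 + α := by linarith
      have : 0 ≤ (1 - Real.cos (x ^ m)) * ((m - 1 + α) / m * x ^ (1 - m - α - 1)) := by positivity
      linarith)
  refine le_trans ?_ key
  have : 0 ≤ (1 - Real.cos (A ^ m)) * A ^ (1 - m - α) / m := by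
    have : 0 ≤ 1 - Real.cos (A ^ m) := by linarith [Real.cos_le_one (A ^ m)]
    positivity
  simp only [Real.one_rpow, mul_one]
  linarith

theorem intervalIntegrable_sin_rpow {m α a b : ℝ} (hα : α < 1) :
    IntervalIntegrable (fun x : ℝ => Real.sin (x ^ m) * x ^ (-α)) MeasureTheory.volume a b := by
  refine (intervalIntegral.intervalIntegrable_rpow' (a := a) (b := b) (r := -α)
    (by linarith)).norm.mono_fun' ?_ ?_
  · exact (by fun_prop : Measurable fun x : ℝ => Real.sin (x ^ m) * x ^ (-α)).aestronglyMeasurable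
  · filter_upwards with x
    rw [norm_mul]
    exact mul_le_of_le_one_left (norm_nonneg _) (Real.abs_sin_le_one _)

theorem exists_pos_le_integral_sin_rpow {m α : ℝ} (hm : 2 ≤ m) (hα0 : 0 ≤ α) (hα1 : α < 1) :
    ∃ c : ℝ, 0 < c ∧ ∀ A : ℝ, 1 ≤ A → c ≤ ∫ x in (0 : ℝ)..A, Real.sin (x ^ m) * x ^ (-α) := by
  have h0 : 3 / 4 / (m + 1) ≤ ∫ x in (0 : ℝ)..1, Real.sin (x ^ m) * x ^ (-α) := by
    have h1 : (3 / 4 / (m + 1 - α)) = ∫ x in (0 : ℝ)..1, 3 / 4 * x ^ (m - α) := by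
      rw [intervalIntegral.integral_const_mul, integral_rpow (Or.inl (by linarith))]
      rw [Real.one_rpow, Real.zero_rpow (by linarith)]
      ring_nf
    have h2 : 3 / 4 / (m + 1) ≤ 3 / 4 / (m + 1 - α) := by
      apply div_le_div_of_nonneg_left <;> linarith
    refine h2.trans (h1.le.trans ?_)
    refine intervalIntegral.integral_mono_on_of_le_Ioo zero_le_one
      ((intervalIntegral.intervalIntegrable_rpow' (by linarith)).const_mul _)
      (intervalIntegrable_sin_rpow hα1) fun x hx => ?_
    have hy0 : 0 < x ^ m := Real.rpow_pos_of_pos hx.1 _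
    have hy1 : x ^ m ≤ 1 := Real.rpow_le_one hx.1.le hx.2.le (by linarith)
    have h3 := Real.sin_gt_sub_cube hy0
    have h4 : (x ^ m) ^ 3 ≤ x ^ m := pow_le_of_le_one hy0.le hy1 (by norm_num)
    have h5 : x ^ (m - α) = x ^ m * x ^ (-α) := by rw [← Real.rpow_add hx.1]; ring_nf
    rw [h5, ← mul_assoc]
    exact mul_le_mul_of_nonneg_right (by linarith) (Real.rpow_nonneg hx.1.le _)
  refine ⟨3 / 4 / (m + 1) - (1 - Real.cos 1) / m, ?_, fun A hA => ?_⟩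
  · have h1 := Real.one_sub_sq_div_two_lt_cos (x := 1) one_ne_zero
    rw [sub_pos, div_lt_div_iff₀ (by linarith) (by linarith)]
    nlinarith
  · rw [← intervalIntegral.integral_add_adjacent_intervals
      (intervalIntegrable_sin_rpow hα1 (a := 0) (b := 1)) (intervalIntegrable_sin_rpow hα1)]
    linarith [sub_le_integral_sin_rpow hm hα0 hA]

/-- The logarithmic weight after rescaling by `Λ`; it tends to `1` as `Λ → ∞`. -/
noncomputable def logWeight (β Λ x : ℝ) : ℝ :=
  (Real.log Λ / (Real.log 2 + Real.log Λ - Real.log x)) ^ β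

/-- The integrand after the change of variables `ξ = x / Λ`. -/
noncomputable def scaledIntegrand (m α β ε Λ x : ℝ) : ℂ :=
  Complex.exp (Complex.I * ((ε * x - x ^ m : ℝ) : ℂ)) * ((x ^ (-α) * logWeight β Λ x : ℝ) : ℂ)

theorem half_le_log_sub_log {Λ x : ℝ} (hx : 0 < x) (hxΛ : x ≤ Λ) :
    1 / 2 ≤ Real.log 2 + Real.log Λ - Real.log x := by
  linarith [Real.log_two_gt_d9, Real.log_le_log hx hxΛ]

theorem logWeight_nonneg {β Λ x : ℝ} (hΛ : 1 ≤ Λ) (hx : 0 < x) (hxΛ : x ≤ Λ) :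
    0 ≤ logWeight β Λ x := by
  have := half_le_log_sub_log hx hxΛ
  exact Real.rpow_nonneg (div_nonneg (Real.log_nonneg hΛ) (by linarith)) _

theorem logWeight_le {β Λ x : ℝ} (hβ : 0 ≤ β) (hΛ : 1 ≤ Λ) (hx : 0 < x) (hxΛ : x ≤ Λ) :
    logWeight β Λ x ≤ (1 + 2 * x) ^ β := by
  have h := half_le_log_sub_log hx hxΛ
  refine Real.rpow_le_rpow (div_nonneg (Real.log_nonneg hΛ) (by linarith)) ?_ hβ
  rw [div_le_iff₀ (by linarith)]
  nlinarith [Real.log_two_gt_d9, Real.log_le_sub_one_of_pos hx]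

theorem logWeight_le_of_one_le {β Λ x : ℝ} (hβ0 : 0 ≤ β) (hβ1 : β ≤ 1) (hx : 1 ≤ x)
    (hxΛ : x ≤ Λ) : logWeight β Λ x ≤ 3 * x ^ β := by
  have h0 : 0 < x := by linarith
  calc logWeight β Λ x ≤ (1 + 2 * x) ^ β := logWeight_le hβ0 (hx.trans hxΛ) h0 hxΛ
    _ ≤ (3 * x) ^ β := Real.rpow_le_rpow (by linarith) (by linarith) hβ0
    _ = 3 ^ β * x ^ β := Real.mul_rpow (by norm_num) h0.le
    _ ≤ 3 ^ (1 : ℝ) * x ^ β := by gcongr; norm_num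
    _ = 3 * x ^ β := by rw [Real.rpow_one]

theorem hasDerivAt_logWeight {β Λ x : ℝ} (hΛ : 1 < Λ) (hx : 0 < x) (hxΛ : x ≤ Λ) :
    HasDerivAt (logWeight β Λ)
      (logWeight β Λ x * (β / (x * (Real.log 2 + Real.log Λ - Real.log x)))) x := by
  have h := half_le_log_sub_log hx hxΛ
  have hd : 0 < Real.log 2 + Real.log Λ - Real.log x := by linarith
  have hl : 0 < Real.log Λ := Real.log_pos hΛ
  have hq : 0 < Real.log Λ / (Real.log 2 + Real.log Λ - Real.log x) := div_pos hl hd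
  have h1 := (((hasDerivAt_const x (Real.log Λ)).div
    ((Real.hasDerivAt_log hx.ne').const_sub (Real.log 2 + Real.log Λ)) hd.ne').rpow_const
      (p := β) (Or.inl hq.ne'))
  refine h1.congr_deriv ?_
  simp only [Pi.div_apply, logWeight]
  rw [Real.rpow_sub_one hq.ne']
  field_simp
  ring

theorem tendsto_logWeight (β : ℝ) (x : ℝ) :
    Filter.Tendsto (fun Λ => logWeight β Λ x) Filter.atTop (nhds 1) := by
  have h0 : Filter.Tendsto (fun l : ℝ => l / (l + (Real.log 2 - Real.log x)))
      Filter.atTop (nhds 1) := by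
    have h1 : Filter.Tendsto (fun l : ℝ => 1 - (Real.log 2 - Real.log x) /
        (l + (Real.log 2 - Real.log x))) Filter.atTop (nhds (1 - 0)) :=
      tendsto_const_nhds.sub (tendsto_const_nhds.div_atTop
        (Filter.tendsto_atTop_add_const_right _ _ Filter.tendsto_id))
    rw [sub_zero] at h1
    refine h1.congr' ?_
    filter_upwards [Filter.eventually_gt_atTop (-(Real.log 2 - Real.log x))] with l hl
    have : l + (Real.log 2 - Real.log x) ≠ 0 := by linarith
    field_simp
    ring
  have h2 := (h0.comp Real.tendsto_log_atTop).rpow_const (p := β) (Or.inl one_ne_zero)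
  rw [Real.one_rpow] at h2
  refine h2.congr fun Λ => ?_
  simp only [logWeight, Function.comp]
  congr 2
  ring

theorem measurable_scaledIntegrand (m α β ε Λ : ℝ) :
    Measurable (scaledIntegrand m α β ε Λ) := by
  unfold scaledIntegrand logWeight
  fun_prop

theorem norm_scaledIntegrand_le {m α β ε Λ x b : ℝ} (hβ : 0 ≤ β) (hΛ : 1 ≤ Λ) (hx : 0 < x)
    (hxb : x ≤ b) (hbΛ : b ≤ Λ) :
    ‖scaledIntegrand m α β ε Λ x‖ ≤ (1 + 2 * b) ^ β * x ^ (-α) := by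
  have h1 := logWeight_nonneg (β := β) hΛ hx (hxb.trans hbΛ)
  have h2 : 0 ≤ x ^ (-α) := Real.rpow_nonneg hx.le _
  rw [scaledIntegrand, norm_mul, Complex.norm_exp_I_mul_ofReal, one_mul, Complex.norm_real,
    Real.norm_of_nonneg (mul_nonneg h2 h1), mul_comm]
  refine mul_le_mul_of_nonneg_right ((logWeight_le hβ hΛ hx (hxb.trans hbΛ)).trans ?_) h2
  exact Real.rpow_le_rpow (by linarith) (by linarith) hβ

theorem intervalIntegrable_scaledIntegrand {m α β ε Λ a b : ℝ} (hα : α < 1) (hβ : 0 ≤ β)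
    (hΛ : 1 ≤ Λ) (ha : 0 ≤ a) (hab : a ≤ b) (hbΛ : b ≤ Λ) :
    IntervalIntegrable (scaledIntegrand m α β ε Λ) MeasureTheory.volume a b := by
  refine ((intervalIntegral.intervalIntegrable_rpow' (a := a) (b := b) (r := -α)
    (by linarith)).const_mul ((1 + 2 * b) ^ β)).mono_fun'
      (measurable_scaledIntegrand m α β ε Λ).aestronglyMeasurable ?_
  filter_upwards [MeasureTheory.ae_restrict_mem measurableSet_uIoc] with x hx
  rw [Set.uIoc_of_le hab] at hx
  exact norm_scaledIntegrand_le hβ hΛ (ha.trans_lt hx.1) hx.2 hbΛ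

theorem norm_integral_scaledIntegrand_tail_le {m α β ε Λ A : ℝ} (hm : 2 ≤ m) (hα0 : 0 ≤ α)
    (hα1 : α < 1) (hβ0 : 0 ≤ β) (hβ1 : β < 1) (hε1 : ε ≤ 1) (hA : 1 ≤ A)
    (hAΛ : A ≤ Λ) (hΛ : 1 < Λ) :
    ‖∫ x in A..Λ, scaledIntegrand m α β ε Λ x‖ ≤
      (6 + 3 * (3 + m * (m - 1)) / (1 - β)) * A ^ (β - 1) := by
  have hβ' : 0 < 1 - β := by linarith
  set D : ℝ → ℝ := fun x => m * x ^ (m - 1) - ε with hDdef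
  set h : ℝ → ℝ := fun x => x ^ (-α) * logWeight β Λ x / D x with hhdef
  set r : ℝ → ℝ := fun x => -α / x + β / (x * (Real.log 2 + Real.log Λ - Real.log x)) -
    m * (m - 1) * x ^ (m - 2) / D x with hrdef
  have hpos : ∀ x ∈ Set.Icc A Λ, 0 < x := fun x hx => by linarith [hx.1]
  have hone : ∀ x ∈ Set.Icc A Λ, 1 ≤ x := fun x hx => hA.trans hx.1
  have hDle : ∀ x ∈ Set.Icc A Λ, x ^ (m - 1) ≤ D x := fun x hx => by
    have := Real.one_le_rpow (hone x hx) (by linarith : 0 ≤ m - 1)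
    simp only [hDdef]
    nlinarith
  have hDx : ∀ x ∈ Set.Icc A Λ, x ≤ D x := fun x hx => by
    refine le_trans ?_ (hDle x hx)
    conv_lhs => rw [← Real.rpow_one x]
    exact Real.rpow_le_rpow_of_exponent_le (hone x hx) (by linarith)
  have hDpos : ∀ x ∈ Set.Icc A Λ, 0 < D x := fun x hx => (hpos x hx).trans_le (hDx x hx)
  have hDd : ∀ x ∈ Set.Icc A Λ, HasDerivAt D (m * (m - 1) * x ^ (m - 2)) x := fun x hx => by
    refine (((Real.hasDerivAt_rpow_const (p := m - 1)
      (Or.inl (hpos x hx).ne')).const_mul m).sub_const ε).congr_deriv ?_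
    rw [show m - 1 - 1 = m - 2 by ring, mul_assoc]
  have hhd : ∀ x ∈ Set.Icc A Λ, HasDerivAt h (h x * r x) x := fun x hx => by
    have hx0 := hpos x hx
    have hd0 := half_le_log_sub_log hx0 hx.2
    have hd1 : Real.log 2 + Real.log Λ - Real.log x ≠ 0 := by linarith
    refine ((((Real.hasDerivAt_rpow_const (p := -α) (Or.inl hx0.ne')).mul
      (hasDerivAt_logWeight (β := β) hΛ hx0 hx.2))).div (hDd x hx) (hDpos x hx).ne').congr_deriv ?_
    have hD0 := (hDpos x hx).ne'
    rw [Real.rpow_sub_one hx0.ne']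
    simp only [hhdef, hrdef, Pi.mul_apply]
    generalize D x = d at *
    field_simp
  have hψ : ∀ x ∈ Set.Icc A Λ, HasDerivAt (fun x => ε * x - x ^ m) (-D x) x := fun x hx => by
    refine (((hasDerivAt_id x).const_mul ε).sub (Real.hasDerivAt_rpow_const (p := m)
      (Or.inl (hpos x hx).ne'))).congr_deriv ?_
    simp only [hDdef]; ring
  have hDc : ContinuousOn D (Set.Icc A Λ) := fun x hx => (hDd x hx).continuousAt.continuousWithinAt
  have hhc : ContinuousOn h (Set.Icc A Λ) := fun x hx => (hhd x hx).continuousAt.continuousWithinAt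
  have hpc : ∀ p : ℝ, ContinuousOn (fun x : ℝ => x ^ p) (Set.Icc A Λ) := fun p =>
    continuousOn_id.rpow_const fun x hx => Or.inl (hpos x hx).ne'
  have hrc : ContinuousOn r (Set.Icc A Λ) := by
    refine ((continuousOn_const.div continuousOn_id fun x hx => (hpos x hx).ne').add
      (continuousOn_const.div (continuousOn_id.mul (continuousOn_const.sub
        (Real.continuousOn_log.mono fun x hx => (hpos x hx).ne'))) fun x hx => ?_)).sub
      ((continuousOn_const.mul (hpc _)).div hDc fun x hx => (hDpos x hx).ne')
    have := half_le_log_sub_log (hpos x hx) hx.2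
    exact mul_ne_zero (hpos x hx).ne' (one_half_pos.trans_le this).ne'
  have hh0 : ∀ x ∈ Set.Icc A Λ, 0 ≤ h x := fun x hx =>
    div_nonneg (mul_nonneg (Real.rpow_nonneg (hpos x hx).le _)
      (logWeight_nonneg hΛ.le (hpos x hx) hx.2)) (hDpos x hx).le
  have hhle : ∀ x ∈ Set.Icc A Λ, h x ≤ 3 * x ^ (β - 1) := fun x hx => by
    have hx0 := hpos x hx
    have h1 : x ^ (-α) ≤ 1 := Real.rpow_le_one_of_one_le_of_nonpos (hone x hx) (by linarith)
    have h2 := logWeight_le_of_one_le hβ0 hβ1.le (hone x hx) hx.2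
    have h3 := logWeight_nonneg (β := β) hΛ.le hx0 hx.2
    calc h x ≤ (1 * (3 * x ^ β)) / x := by
          simp only [hhdef]
          have := hDx x hx
          gcongr
      _ = 3 * x ^ (β - 1) := by rw [Real.rpow_sub_one hx0.ne']; ring
  have hrle : ∀ x ∈ Set.Icc A Λ, |r x| ≤ (3 + m * (m - 1)) / x := fun x hx => by
    have hx0 := hpos x hx
    have hd0 := half_le_log_sub_log hx0 hx.2
    have h1 : |-α / x| ≤ 1 / x := by
      rw [abs_div, abs_neg, abs_of_nonneg hα0, abs_of_pos hx0]
      gcongr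
    have h2 : |β / (x * (Real.log 2 + Real.log Λ - Real.log x))| ≤ 2 / x := by
      rw [abs_of_nonneg (div_nonneg hβ0 (mul_nonneg hx0.le (by linarith))),
        div_le_div_iff₀ (mul_pos hx0 (by linarith)) hx0]
      nlinarith
    have h3 : |m * (m - 1) * x ^ (m - 2) / D x| ≤ m * (m - 1) / x := by
      have hm1 : 0 ≤ m * (m - 1) := mul_nonneg (by linarith) (by linarith)
      have hp := Real.rpow_pos_of_pos hx0 (m - 2)
      rw [abs_of_nonneg (div_nonneg (mul_nonneg hm1 hp.le) (hDpos x hx).le),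
        div_le_div_iff₀ (hDpos x hx) hx0, mul_assoc]
      refine mul_le_mul_of_nonneg_left (le_trans (le_of_eq ?_) (hDle x hx)) hm1
      rw [← Real.rpow_add_one hx0.ne']; ring_nf
    calc |r x| ≤ |-α / x| + |β / (x * (Real.log 2 + Real.log Λ - Real.log x))| +
          |m * (m - 1) * x ^ (m - 2) / D x| :=
          (abs_sub _ _).trans (add_le_add_left (abs_add_le _ _) _)
      _ ≤ 1 / x + 2 / x + m * (m - 1) / x := by gcongr
      _ = _ := by ring
  have hm1 : 0 ≤ 3 + m * (m - 1) := by nlinarith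
  have key := norm_integral_exp_mul_le (B := fun x => 3 * (3 + m * (m - 1)) * x ^ (β - 2)) hAΛ hψ
    hhd hDc (hhc.mul hrc) (continuousOn_const.mul (hpc _)) fun x hx => by
      have hx0 := hpos x hx
      rw [abs_mul, abs_of_nonneg (hh0 x hx)]
      calc h x * |r x| ≤ (3 * x ^ (β - 1)) * ((3 + m * (m - 1)) / x) :=
            mul_le_mul (hhle x hx) (hrle x hx) (abs_nonneg _) (by positivity)
        _ = _ := by
          rw [show β - 2 = β - 1 - 1 by ring, Real.rpow_sub_one hx0.ne' (β - 1)]; ring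
  have hcongr : ∫ x in A..Λ, scaledIntegrand m α β ε Λ x =
      ∫ x in A..Λ, Complex.exp (Complex.I * ((ε * x - x ^ m : ℝ) : ℂ)) *
        ((D x * h x : ℝ) : ℂ) := by
    refine intervalIntegral.integral_congr fun x hx => ?_
    rw [Set.uIcc_of_le hAΛ] at hx
    simp only [scaledIntegrand, hhdef]
    rw [mul_div_cancel₀ _ (hDpos x hx).ne']
  rw [hcongr]
  refine key.trans ?_
  have hA0 : 0 < A := by linarith
  have hmA : A ∈ Set.Icc A Λ := ⟨le_rfl, hAΛ⟩
  have hmΛ : Λ ∈ Set.Icc A Λ := ⟨hAΛ, le_rfl⟩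
  have hΛA : Λ ^ (β - 1) ≤ A ^ (β - 1) := Real.rpow_le_rpow_of_nonpos hA0 hAΛ (by linarith)
  have hint : ∫ x in A..Λ, 3 * (3 + m * (m - 1)) * x ^ (β - 2) ≤
      3 * (3 + m * (m - 1)) / (1 - β) * A ^ (β - 1) := by
    rw [intervalIntegral.integral_const_mul, integral_rpow (Or.inr ⟨by linarith, by
      rw [Set.uIcc_of_le hAΛ]; exact fun h0 => absurd (hpos 0 h0) (lt_irrefl _)⟩),
      show β - 2 + 1 = β - 1 by ring]
    have h1 : (Λ ^ (β - 1) - A ^ (β - 1)) / (β - 1) ≤ A ^ (β - 1) / (1 - β) := by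
      rw [← neg_div_neg_eq, neg_sub, neg_sub]
      have := Real.rpow_nonneg (hA0.le.trans hAΛ) (β - 1)
      gcongr
      linarith
    calc _ ≤ 3 * (3 + m * (m - 1)) * (A ^ (β - 1) / (1 - β)) := by gcongr
      _ = _ := by ring
  rw [abs_of_nonneg (hh0 A hmA), abs_of_nonneg (hh0 Λ hmΛ)]
  linarith [hhle A hmA, hhle Λ hmΛ]

theorem tendsto_integral_scaledIntegrand {m α β A : ℝ} (hα1 : α < 1) (hβ0 : 0 ≤ β)
    (hA : 0 ≤ A) :
    Filter.Tendsto (fun p : ℝ × ℝ => ∫ x in (0 : ℝ)..A, scaledIntegrand m α β p.1 p.2 x)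
      (nhds 0 ×ˢ Filter.atTop)
      (nhds (∫ x in (0 : ℝ)..A, Complex.exp (Complex.I * ((-x ^ m : ℝ) : ℂ)) *
        ((x ^ (-α) : ℝ) : ℂ))) := by
  refine intervalIntegral.tendsto_integral_filter_of_dominated_convergence
    (fun x => (1 + 2 * A) ^ β * x ^ (-α)) ?_ ?_
    ((intervalIntegral.intervalIntegrable_rpow' (by linarith)).const_mul _) ?_
  · exact Filter.Eventually.of_forall fun p =>
      (measurable_scaledIntegrand m α β p.1 p.2).aestronglyMeasurable
  · have h1 : ∀ᶠ p : ℝ × ℝ in nhds 0 ×ˢ Filter.atTop, max 1 A ≤ p.2 :=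
      Filter.tendsto_snd.eventually (Filter.eventually_ge_atTop _)
    filter_upwards [h1] with p hp
    filter_upwards with x hx
    rw [Set.uIoc_of_le hA] at hx
    exact norm_scaledIntegrand_le hβ0 ((le_max_left _ _).trans hp) hx.1 hx.2
      ((le_max_right _ _).trans hp)
  · filter_upwards with x hx
    have h1 : Filter.Tendsto (fun p : ℝ × ℝ => p.1 * x - x ^ m) (nhds 0 ×ˢ Filter.atTop)
        (nhds (0 * x - x ^ m)) := (Filter.tendsto_fst.mul_const x).sub_const _
    have h2 : Filter.Tendsto (fun p : ℝ × ℝ => x ^ (-α) * logWeight β p.2 x)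
        (nhds (0 : ℝ) ×ˢ Filter.atTop) (nhds (x ^ (-α) * 1)) :=
      ((tendsto_logWeight β x).comp Filter.tendsto_snd).const_mul _
    rw [zero_mul, zero_sub] at h1
    rw [mul_one] at h2
    exact (((Complex.continuous_ofReal.tendsto _).comp h1).const_mul Complex.I).cexp.mul
      ((Complex.continuous_ofReal.tendsto _).comp h2)

theorem integral_sin_rpow_le_norm {m α A : ℝ} (hα1 : α < 1) :
    ∫ x in (0 : ℝ)..A, Real.sin (x ^ m) * x ^ (-α) ≤
      ‖∫ x in (0 : ℝ)..A, Complex.exp (Complex.I * ((-x ^ m : ℝ) : ℂ)) *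
        ((x ^ (-α) : ℝ) : ℂ)‖ := by
  set f : ℝ → ℂ := fun x => Complex.exp (Complex.I * ((-x ^ m : ℝ) : ℂ)) * ((x ^ (-α) : ℝ) : ℂ)
  have hf : IntervalIntegrable f MeasureTheory.volume 0 A := by
    refine (intervalIntegral.intervalIntegrable_rpow' (a := 0) (b := A) (r := -α)
      (by linarith)).norm.mono_fun' ?_ ?_
    · exact (by fun_prop : Measurable f).aestronglyMeasurable
    · filter_upwards with x
      simp only [f, norm_mul, Complex.norm_exp_I_mul_ofReal, one_mul, Complex.norm_real]
      exact le_rfl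
  have h1 : ∫ x in (0 : ℝ)..A, (f x).im = (∫ x in (0 : ℝ)..A, f x).im :=
    Complex.imCLM.intervalIntegral_comp_comm hf
  have h2 : ∀ x, (f x).im = -(Real.sin (x ^ m) * x ^ (-α)) := fun x => by
    simp only [f, Complex.im_mul_ofReal]
    rw [mul_comm Complex.I, Complex.exp_ofReal_mul_I_im, Real.sin_neg, neg_mul]
  simp only [h2, intervalIntegral.integral_neg] at h1
  calc _ = -(∫ x in (0 : ℝ)..A, f x).im := by rw [← h1, neg_neg]
    _ ≤ _ := (neg_le_abs _).trans (Complex.abs_im_le_norm _)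

theorem exists_le_norm_integral_scaledIntegrand {m α β : ℝ} (hm : 2 ≤ m) (hα0 : 0 ≤ α)
    (hα1 : α < 1) (hβ0 : 0 ≤ β) (hβ1 : β < 1) :
    ∃ c ε₀ Λ₀ : ℝ, 0 < c ∧ 0 < ε₀ ∧ 1 < Λ₀ ∧ ∀ ε Λ : ℝ, 0 ≤ ε → ε ≤ ε₀ → Λ₀ ≤ Λ →
      c ≤ ‖∫ x in (0 : ℝ)..Λ, scaledIntegrand m α β ε Λ x‖ := by
  obtain ⟨c, hc, hcA⟩ := exists_pos_le_integral_sin_rpow hm hα0 hα1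
  obtain ⟨A, hA1, hA⟩ : ∃ A : ℝ, 1 ≤ A ∧
      (6 + 3 * (3 + m * (m - 1)) / (1 - β)) * A ^ (β - 1) < c / 4 := by
    have h1 : Filter.Tendsto (fun A : ℝ => (6 + 3 * (3 + m * (m - 1)) / (1 - β)) * A ^ (β - 1))
        Filter.atTop (nhds ((6 + 3 * (3 + m * (m - 1)) / (1 - β)) * 0)) := by
      have := tendsto_rpow_neg_atTop (y := 1 - β) (by linarith)
      rw [neg_sub] at this
      exact this.const_mul _
    rw [mul_zero] at h1
    exact ((Filter.eventually_ge_atTop 1).and (h1.eventually_lt_const (by linarith))).exists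
  have hlim := (tendsto_integral_scaledIntegrand (m := m) hα1 hβ0
    (by linarith : 0 ≤ A)).norm.eventually_const_lt
      (u := c / 2) (by linarith [hcA A hA1, integral_sin_rpow_le_norm (m := m) (A := A) hα1])
  obtain ⟨P, hP, Q, hQ, hPQ⟩ := Filter.eventually_prod_iff.1 hlim
  obtain ⟨δ, hδ, hPδ⟩ := Metric.eventually_nhds_iff.1 hP
  obtain ⟨R, hR⟩ := Filter.eventually_atTop.1 hQ
  refine ⟨c / 4, min 1 (δ / 2), max (max A 2) R, by linarith, by positivity,
    lt_of_lt_of_le one_lt_two ((le_max_right _ _).trans (le_max_left _ _)),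
    fun ε Λ hε0 hε hΛ => ?_⟩
  have hΛA : A ≤ Λ := ((le_max_left _ _).trans (le_max_left _ _)).trans hΛ
  have hΛ2 : 2 ≤ Λ := ((le_max_right _ _).trans (le_max_left _ _)).trans hΛ
  have h1 := hPQ (hPδ (y := ε) (by
    rw [Real.dist_eq, sub_zero, abs_of_nonneg hε0]
    linarith [hε.trans (min_le_right _ _)])) (hR Λ ((le_max_right _ _).trans hΛ))
  have h2 := norm_integral_scaledIntegrand_tail_le hm hα0 hα1 hβ0 hβ1
    (hε.trans (min_le_left _ _)) hA1 hΛA (by linarith)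
  rw [← intervalIntegral.integral_add_adjacent_intervals
    (intervalIntegrable_scaledIntegrand hα1 hβ0 (by linarith) le_rfl (by linarith) hΛA)
    (intervalIntegrable_scaledIntegrand hα1 hβ0 (by linarith) (by linarith) hΛA le_rfl)]
  have h3 := norm_sub_le_norm_add (∫ x in (0 : ℝ)..A, scaledIntegrand m α β ε Λ x)
    (∫ x in A..Λ, scaledIntegrand m α β ε Λ x)
  simp only at h1
  linarith

theorem integral_eq_integral_scaledIntegrand {m α β μ Λ : ℝ} (hΛ : 1 < Λ) :
    ∫ ξ in (0:ℝ)..1, Complex.exp (Complex.I * ((μ * ξ - Λ ^ m * ξ ^ m : ℝ) : ℂ)) *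
        ((ξ ^ (-α) * |Real.log (ξ / 2)| ^ (-β) : ℝ) : ℂ) =
      ((Λ ^ (α - 1) * Real.log Λ ^ (-β) : ℝ) : ℂ) *
        ∫ x in (0 : ℝ)..Λ, scaledIntegrand m α β (μ / Λ) Λ x := by
  have hΛ0 : 0 < Λ := by linarith
  have hl : 0 < Real.log Λ := Real.log_pos hΛ
  have h1 := intervalIntegral.integral_comp_div (a := 0) (b := Λ) (fun ξ : ℝ =>
    Complex.exp (Complex.I * ((μ * ξ - Λ ^ m * ξ ^ m : ℝ) : ℂ)) *
        ((ξ ^ (-α) * |Real.log (ξ / 2)| ^ (-β) : ℝ) : ℂ)) hΛ0.ne'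
  rw [zero_div, div_self hΛ0.ne'] at h1
  rw [← inv_smul_eq_iff₀ hΛ0.ne'] at h1
  rw [← h1, ← intervalIntegral.integral_smul, ← intervalIntegral.integral_const_mul]
  refine intervalIntegral.integral_congr_ae ?_
  filter_upwards with x hx
  rw [Set.uIoc_of_le hΛ0.le] at hx
  have hx0 := hx.1
  have hd := half_le_log_sub_log hx0 hx.2
  have hlog : |Real.log (x / Λ / 2)| = Real.log 2 + Real.log Λ - Real.log x := by
    rw [Real.log_div (by positivity) two_ne_zero, Real.log_div hx0.ne' hΛ0.ne', abs_of_nonpos]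
    · ring
    · linarith
  have hphase : μ * (x / Λ) - Λ ^ m * (x / Λ) ^ m = μ / Λ * x - x ^ m := by
    rw [Real.div_rpow hx0.le hΛ0.le, mul_div_cancel₀ _ (Real.rpow_pos_of_pos hΛ0 m).ne']
    ring
  have hamp : Λ⁻¹ * ((x / Λ) ^ (-α) * (Real.log 2 + Real.log Λ - Real.log x) ^ (-β)) =
      Λ ^ (α - 1) * Real.log Λ ^ (-β) * (x ^ (-α) * logWeight β Λ x) := by
    rw [logWeight, Real.div_rpow hx0.le hΛ0.le, Real.div_rpow hl.le (by linarith),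
      Real.rpow_sub_one hΛ0.ne', Real.rpow_neg hΛ0.le, Real.rpow_neg hl.le,
      Real.rpow_neg (by linarith : 0 ≤ Real.log 2 + Real.log Λ - Real.log x)]
    have := (Real.rpow_pos_of_pos hl β).ne'
    field_simp
  rw [hlog, hphase, scaledIntegrand, Complex.real_smul, mul_left_comm, ← Complex.ofReal_mul,
    hamp, Complex.ofReal_mul (Λ ^ (α - 1) * _), mul_left_comm]

/-- Lower bound for the oscillatory integral
`∫₀¹ e^{i(μξ - λξ^m)} ξ^{-α} |log(ξ/2)|^{-β} dξ` in the regime `1 ≪ μ^m ≪ λ`: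
it is bounded below by a constant times `λ^{(α-1)/m} (log λ)^{-β}`. -/
theorem stmt_3 (m α β : ℝ) (hm : 2 ≤ m) (hα0 : 0 ≤ α) (hα1 : α < 1)
    (hβ0 : 0 ≤ β) (hβ1 : β < 1) :
    ∃ c M : ℝ, 0 < c ∧ 0 < M ∧
      ∀ μ lam : ℝ, 1 ≤ μ → M ≤ μ ^ m → M * μ ^ m ≤ lam →
        c * lam ^ ((α - 1) / m) * Real.log lam ^ (-β) ≤
          ‖∫ ξ in (0:ℝ)..1,
            Complex.exp (Complex.I * ((μ * ξ - lam * ξ ^ m : ℝ) : ℂ)) *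
              ((ξ ^ (-α) * |Real.log (ξ / 2)| ^ (-β) : ℝ) : ℂ)‖ := by
  obtain ⟨c, ε₀, Λ₀, hc, hε₀, hΛ₀, H⟩ :=
    exists_le_norm_integral_scaledIntegrand hm hα0 hα1 hβ0 hβ1
  have hm0 : 0 < m := by linarith
  have hΛ₀0 : 0 < Λ₀ := by linarith
  refine ⟨c, max (Λ₀ ^ m) ((ε₀⁻¹) ^ m), hc, lt_max_of_lt_left (Real.rpow_pos_of_pos hΛ₀0 m),
    fun μ lam hμ _ hlam => ?_⟩
  have hμ0 : 0 < μ := by linarith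
  have hμm : 1 ≤ μ ^ m := Real.one_le_rpow hμ hm0.le
  have h1 : Λ₀ ^ m ≤ lam := by
    have := Real.rpow_nonneg hΛ₀0.le m
    nlinarith [le_max_left (Λ₀ ^ m) ((ε₀⁻¹) ^ m)]
  have h2 : (ε₀⁻¹ * μ) ^ m ≤ lam := by
    rw [Real.mul_rpow (by positivity) hμ0.le]
    exact (mul_le_mul_of_nonneg_right (le_max_right _ _) (by linarith)).trans hlam
  have hlam0 : 0 ≤ lam := (Real.rpow_nonneg hΛ₀0.le m).trans h1
  obtain ⟨Λ, hΛ0, rfl⟩ : ∃ Λ : ℝ, 0 ≤ Λ ∧ Λ ^ m = lam :=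
    ⟨lam ^ m⁻¹, Real.rpow_nonneg hlam0 _, Real.rpow_inv_rpow hlam0 hm0.ne'⟩
  have hΛ : Λ₀ ≤ Λ := (Real.rpow_le_rpow_iff hΛ₀0.le hΛ0 hm0).1 h1
  have hΛμ : ε₀⁻¹ * μ ≤ Λ := (Real.rpow_le_rpow_iff (by positivity) hΛ0 hm0).1 h2
  have hΛ1 : 1 < Λ := by linarith
  have hl : 0 < Real.log Λ := Real.log_pos hΛ1
  have hε : μ / Λ ≤ ε₀ := by
    rw [div_le_iff₀ (by linarith)]
    rwa [inv_mul_le_iff₀ hε₀] at hΛμ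
  have hF := H (μ / Λ) Λ (by positivity) hε hΛ
  rw [integral_eq_integral_scaledIntegrand hΛ1, norm_mul, Complex.norm_real,
    Real.norm_of_nonneg (by positivity), ← Real.rpow_mul hΛ0, mul_div_cancel₀ _ hm0.ne',
    Real.log_rpow (by linarith)]
  have hlog : (m * Real.log Λ) ^ (-β) ≤ Real.log Λ ^ (-β) :=
    Real.rpow_le_rpow_of_nonpos hl (by nlinarith) (by linarith)
  calc c * Λ ^ (α - 1) * (m * Real.log Λ) ^ (-β)
      ≤ c * Λ ^ (α - 1) * Real.log Λ ^ (-β) := by gcongr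
    _ = Λ ^ (α - 1) * Real.log Λ ^ (-β) * c := by ring
    _ ≤ _ := by gcongr
end

section
/- Let m ≥ 2 and suppose 1 ≪ μ ≪ λ ≪ μ^m. Then for δ > 0 sufficiently small, |∫₀^δ e^{i(μξ − λ(ξ^m + O(ξ^{m+1})))} dξ| ≥ C_δ μ^{−(m−2)/(2m−2)} λ^{−1/(2m−2)}. -/
/-- A uniform lower bound for the truncated Fresnel sine integral. -/
theorem fresnel_sine_lower_bound {K : ℝ} (hK : 1 ≤ K) :
    1 / 30 ≤ ∫ u in (0 : ℝ)..K, Real.sin (u ^ 2 / 2) := by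
  have hcont : Continuous fun u : ℝ => Real.sin (u ^ 2 / 2) := by fun_prop
  have hmono : MonotoneOn
      (fun x : ℝ => (∫ u in (0 : ℝ)..x, Real.sin (u ^ 2 / 2)) - (1 - Real.cos (x ^ 2 / 2)) / x)
      (Set.Ici 1) := by
    have hd : ∀ x ∈ Set.Ici (1 : ℝ), HasDerivAt
        (fun x : ℝ => (∫ u in (0 : ℝ)..x, Real.sin (u ^ 2 / 2)) - (1 - Real.cos (x ^ 2 / 2)) / x)
        ((1 - Real.cos (x ^ 2 / 2)) / x ^ 2) x := by
      intro x hx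
      have hx0 : x ≠ 0 := by
        have : (1 : ℝ) ≤ x := hx
        positivity
      have h1 : HasDerivAt (fun x : ℝ => ∫ u in (0 : ℝ)..x, Real.sin (u ^ 2 / 2))
          (Real.sin (x ^ 2 / 2)) x :=
        intervalIntegral.integral_hasDerivAt_right (hcont.intervalIntegrable _ _)
          (hcont.stronglyMeasurableAtFilter _ _) hcont.continuousAt
      have h2 : HasDerivAt (fun x : ℝ => x ^ 2 / 2) x x := by
        have := (hasDerivAt_pow 2 x).div_const 2
        simpa using this
      have h3 := ((h2.cos.const_sub 1).div (hasDerivAt_id x) hx0)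
      refine (h1.sub h3).congr_deriv ?_
      simp only [id]
      field_simp
      ring
    refine monotoneOn_of_hasDerivWithinAt_nonneg (convex_Ici 1)
      (fun x hx => (hd x hx).continuousAt.continuousWithinAt)
      (fun x hx => (hd x (interior_subset hx)).hasDerivWithinAt) fun x _ => ?_
    have := Real.cos_le_one (x ^ 2 / 2)
    have : 0 ≤ 1 - Real.cos (x ^ 2 / 2) := by linarith
    positivity
  have h01 : (1 : ℝ) / 6 - 1 / 336 ≤ ∫ u in (0 : ℝ)..1, Real.sin (u ^ 2 / 2) := by
    have hint : ∫ u in (0 : ℝ)..1, (u ^ 2 / 2 - u ^ 6 / 48) = (1 : ℝ) / 6 - 1 / 336 := by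
      rw [intervalIntegral.integral_sub (Continuous.intervalIntegrable (by fun_prop) _ _)
        (Continuous.intervalIntegrable (by fun_prop) _ _)]
      simp only [intervalIntegral.integral_div, integral_pow]
      norm_num
    rw [← hint]
    refine intervalIntegral.integral_mono_on zero_le_one
      (Continuous.intervalIntegrable (by fun_prop) _ _) (hcont.intervalIntegrable _ _) ?_
    intro u _
    rcases eq_or_ne u 0 with rfl | hu
    · simp
    · have := (Real.sin_gt_sub_cube (x := u ^ 2 / 2) (by positivity)).le
      calc u ^ 2 / 2 - u ^ 6 / 48 = u ^ 2 / 2 - (u ^ 2 / 2) ^ 3 / 6 := by ring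
        _ ≤ _ := this
  have hm := hmono (Set.mem_Ici.2 le_rfl) (Set.mem_Ici.2 hK) hK
  have hc : (1 : ℝ) - (1 / 2) ^ 2 / 2 ≤ Real.cos (1 / 2) := Real.one_sub_sq_div_two_le_cos
  have hKc : 0 ≤ (1 - Real.cos (K ^ 2 / 2)) / K := by
    have := Real.cos_le_one (K ^ 2 / 2)
    exact div_nonneg (by linarith) (by linarith)
  norm_num at hm hc
  linarith

/-- Lower bound for the oscillatory integral of a quadratic phase over a window of
`K` standard widths around its critical point. -/
theorem norm_integral_exp_quadratic_ge {K q : ℝ} (hK : 1 ≤ K) (hq : 0 < q) (c w : ℝ) :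
    1 / (15 * q) ≤ ‖∫ x in (c - K / q)..(c + K / q),
      Complex.exp (Complex.I * ((w - q ^ 2 * (x - c) ^ 2 / 2 : ℝ) : ℂ))‖ := by
  have hcont : Continuous fun u : ℝ => Complex.exp (Complex.I * ((-(u ^ 2 / 2) : ℝ) : ℂ)) := by
    fun_prop
  have hsin : Continuous fun u : ℝ => Real.sin (u ^ 2 / 2) := by fun_prop
  have hfac : ∀ x : ℝ, Complex.exp (Complex.I * ((w - q ^ 2 * (x - c) ^ 2 / 2 : ℝ) : ℂ)) =
      Complex.exp (Complex.I * (w : ℂ)) *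
        (fun u : ℝ => Complex.exp (Complex.I * ((-(u ^ 2 / 2) : ℝ) : ℂ))) (q * x - q * c) := by
    intro x
    simp only
    rw [← Complex.exp_add]
    congr 1
    push_cast
    ring
  have hsub := intervalIntegral.integral_comp_mul_sub (a := c - K / q) (b := c + K / q)
    (fun u : ℝ => Complex.exp (Complex.I * ((-(u ^ 2 / 2) : ℝ) : ℂ))) hq.ne' (q * c)
  have e1 : q * (c - K / q) - q * c = -K := by field_simp; ring
  have e2 : q * (c + K / q) - q * c = K := by field_simp; ring
  rw [e1, e2] at hsub
  simp_rw [hfac]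
  rw [intervalIntegral.integral_const_mul, hsub, norm_mul, Complex.norm_exp_I_mul_ofReal, one_mul,
    norm_smul, Real.norm_of_nonneg (inv_nonneg.2 hq.le)]
  have him : (∫ u in (-K)..K, Complex.exp (Complex.I * ((-(u ^ 2 / 2) : ℝ) : ℂ))).im =
      ∫ u in (-K)..K, -Real.sin (u ^ 2 / 2) := by
    have := intervalIntegral.intervalIntegral_im (𝕜 := ℂ)
      (hcont.intervalIntegrable (μ := MeasureTheory.volume) (-K) K)
    simp only [RCLike.im_eq_complex_im] at this
    rw [← this]
    refine intervalIntegral.integral_congr fun u _ => ?_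
    rw [mul_comm, Complex.exp_ofReal_mul_I_im, Real.sin_neg]
  have hsym : ∫ u in (-K)..K, Real.sin (u ^ 2 / 2) =
      2 * ∫ u in (0 : ℝ)..K, Real.sin (u ^ 2 / 2) := by
    rw [← intervalIntegral.integral_add_adjacent_intervals (b := 0)
      (hsin.intervalIntegrable _ _) (hsin.intervalIntegrable _ _), two_mul]
    congr 1
    have := intervalIntegral.integral_comp_neg (a := -K) (b := 0)
      (fun u : ℝ => Real.sin (u ^ 2 / 2))
    simpa using this
  have hF := fresnel_sine_lower_bound hK
  have hle := Complex.abs_im_le_norm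
    (∫ u in (-K)..K, Complex.exp (Complex.I * ((-(u ^ 2 / 2) : ℝ) : ℂ)))
  rw [him, intervalIntegral.integral_neg, abs_neg, hsym, abs_of_nonneg (by linarith)] at hle
  calc 1 / (15 * q) = q⁻¹ * (2 * (1 / 30)) := by field_simp; norm_num
    _ ≤ _ := by gcongr; linarith

/-- First derivative test for oscillatory integrals with a concave phase. -/
theorem norm_integral_exp_le_of_concave {F f g : ℝ → ℝ} (hF : ∀ x, HasDerivAt F (f x) x)
    (hf : ∀ x, HasDerivAt f (g x) x) (hg : Continuous g) {a b L : ℝ} (hab : a ≤ b) (hL : 0 < L)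
    (hg0 : ∀ x ∈ Set.Icc a b, g x ≤ 0) (hfL : ∀ x ∈ Set.Icc a b, L ≤ |f x|) :
    ‖∫ x in a..b, Complex.exp (Complex.I * (F x : ℂ))‖ ≤ 4 / L := by
  have hFc : Continuous F := continuous_iff_continuousAt.2 fun x => (hF x).continuousAt
  have hfc : Continuous f := continuous_iff_continuousAt.2 fun x => (hf x).continuousAt
  have hf0 : ∀ x ∈ Set.uIcc a b, f x ≠ 0 := by
    intro x hx
    rw [Set.uIcc_of_le hab] at hx
    exact abs_pos.1 (hL.trans_le (hfL x hx))
  have hinv : ∀ x ∈ Set.uIcc a b, HasDerivAt (fun x => (f x)⁻¹) (-g x / f x ^ 2) x :=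
    fun x hx => (hf x).inv (hf0 x hx)
  have hcinv : ContinuousOn (fun x => -g x / f x ^ 2) (Set.uIcc a b) :=
    hg.neg.continuousOn.div (by fun_prop) fun x hx => pow_ne_zero 2 (hf0 x hx)
  have hexp : ∀ x, HasDerivAt (fun x => -Complex.I * Complex.exp (Complex.I * (F x : ℂ)))
      (Complex.exp (Complex.I * (F x : ℂ)) * f x) x := by
    intro x
    have := ((((hF x).ofReal_comp).const_mul Complex.I).cexp).const_mul (-Complex.I)
    refine this.congr_deriv ?_
    linear_combination (-Complex.exp (Complex.I * (F x : ℂ)) * f x) * Complex.I_mul_I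
  have hparts := intervalIntegral.integral_deriv_mul_eq_sub (a := a) (b := b)
    (fun x _ => hexp x) (fun x hx => (hinv x hx).ofReal_comp)
    (Continuous.intervalIntegrable (by fun_prop) _ _)
    (ContinuousOn.intervalIntegrable (Complex.continuous_ofReal.comp_continuousOn hcinv))
  have hpi : IntervalIntegrable (fun x => -Complex.I * Complex.exp (Complex.I * (F x : ℂ)) *
      ((-g x / f x ^ 2 : ℝ) : ℂ)) MeasureTheory.volume a b := by
    refine ContinuousOn.intervalIntegrable (ContinuousOn.mul (by fun_prop)
      (Complex.continuous_ofReal.comp_continuousOn hcinv))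
  have hsplit : ∫ x in a..b, Complex.exp (Complex.I * (F x : ℂ)) =
      (∫ x in a..b, (Complex.exp (Complex.I * (F x : ℂ)) * f x * (((f x)⁻¹ : ℝ) : ℂ) +
        -Complex.I * Complex.exp (Complex.I * (F x : ℂ)) * ((-g x / f x ^ 2 : ℝ) : ℂ))) -
      ∫ x in a..b, -Complex.I * Complex.exp (Complex.I * (F x : ℂ)) *
        ((-g x / f x ^ 2 : ℝ) : ℂ) := by
    have hcongr : ∫ x in a..b, (Complex.exp (Complex.I * (F x : ℂ)) * f x * (((f x)⁻¹ : ℝ) : ℂ) +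
        -Complex.I * Complex.exp (Complex.I * (F x : ℂ)) * ((-g x / f x ^ 2 : ℝ) : ℂ)) =
        ∫ x in a..b, (Complex.exp (Complex.I * (F x : ℂ)) +
        -Complex.I * Complex.exp (Complex.I * (F x : ℂ)) * ((-g x / f x ^ 2 : ℝ) : ℂ)) := by
      refine intervalIntegral.integral_congr fun x hx => ?_
      have : (f x : ℂ) ≠ 0 := by exact_mod_cast hf0 x hx
      simp only [Complex.ofReal_inv]
      rw [mul_assoc (Complex.exp _), mul_inv_cancel₀ this, mul_one]
    rw [hcongr, intervalIntegral.integral_add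
      (Continuous.intervalIntegrable (by fun_prop) _ _) hpi]
    ring
  have hrem : ‖∫ x in a..b, -Complex.I * Complex.exp (Complex.I * (F x : ℂ)) *
      ((-g x / f x ^ 2 : ℝ) : ℂ)‖ ≤ (f b)⁻¹ - (f a)⁻¹ := by
    rw [← intervalIntegral.integral_eq_sub_of_hasDerivAt hinv hcinv.intervalIntegrable]
    refine intervalIntegral.norm_integral_le_of_norm_le hab ?_ hcinv.intervalIntegrable
    refine Filter.Eventually.of_forall fun x hx => ?_
    have := hg0 x (Set.Ioc_subset_Icc_self hx)
    rw [norm_mul, norm_mul, norm_neg, Complex.norm_I, Complex.norm_exp_I_mul_ofReal,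
      Complex.norm_real, Real.norm_of_nonneg (div_nonneg (by linarith) (sq_nonneg _))]
    simp
  have hend : ∀ x ∈ Set.Icc a b, |(f x)⁻¹| ≤ 1 / L := by
    intro x hx
    rw [abs_inv, one_div]
    exact inv_anti₀ hL (hfL x hx)
  have hbd : ∀ x ∈ Set.Icc a b, ‖-Complex.I * Complex.exp (Complex.I * (F x : ℂ)) *
      (((f x)⁻¹ : ℝ) : ℂ)‖ ≤ 1 / L := by
    intro x hx
    rw [norm_mul, norm_mul, norm_neg, Complex.norm_I, Complex.norm_exp_I_mul_ofReal,
      Complex.norm_real, Real.norm_eq_abs]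
    simpa using hend x hx
  have ha := Set.left_mem_Icc.2 hab
  have hb := Set.right_mem_Icc.2 hab
  rw [hsplit, hparts]
  refine (norm_sub_le _ _).trans ?_
  have h1 := (norm_sub_le _ _).trans (add_le_add (hbd b hb) (hbd a ha))
  have h2 := abs_le.1 (hend a ha)
  have h3 := abs_le.1 (hend b hb)
  have : 4 / L = 1 / L + 1 / L + (1 / L + 1 / L) := by ring
  rw [this]
  refine add_le_add h1 (hrem.trans ?_)
  linarith [h2.1, h3.2]

theorem norm_exp_I_mul_sub_exp_I_mul_le (x y : ℝ) :
    ‖Complex.exp (Complex.I * (x : ℂ)) - Complex.exp (Complex.I * (y : ℂ))‖ ≤ |x - y| := by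
  have h : Complex.exp (Complex.I * (x : ℂ)) - Complex.exp (Complex.I * (y : ℂ)) =
      Complex.exp (Complex.I * (y : ℂ)) * (Complex.exp (Complex.I * ((x - y : ℝ) : ℂ)) - 1) := by
    rw [mul_sub, ← Complex.exp_add, mul_one]
    congr 2
    push_cast
    ring
  rw [h, norm_mul, Complex.norm_exp_I_mul_ofReal, one_mul]
  exact Real.norm_exp_I_mul_ofReal_sub_one_le

/-- Lower bound for the oscillatory integral of a concave phase near a nondegenerate
critical point, assuming only that the second derivative is almost constant there. -/
theorem norm_integral_exp_ge_of_concave {F f g : ℝ → ℝ} (hF : ∀ x, HasDerivAt F (f x) x)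
    (hf : ∀ x, HasDerivAt f (g x) x) (hg : Continuous g) {a b c q K : ℝ} (hK : 1600 ≤ K)
    (hq : 0 < q) (hac : a ≤ c - K / q) (hcb : c + K / q ≤ b) (hc : f c = 0)
    (hg0 : ∀ x ∈ Set.Icc a b, g x ≤ 0)
    (hgq : ∀ x ∈ Set.Icc (c - K / q) (c + K / q), |g x + q ^ 2| ≤ q ^ 2 / (1000 * K ^ 3)) :
    1 / (30 * q) ≤ ‖∫ x in a..b, Complex.exp (Complex.I * (F x : ℂ))‖ := by
  have hK0 : 0 < K := by linarith
  have hr : 0 < K / q := by positivity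
  have hFc : Continuous F := continuous_iff_continuousAt.2 fun x => (hF x).continuousAt
  have hint : ∀ s t : ℝ, IntervalIntegrable (fun x => Complex.exp (Complex.I * (F x : ℂ)))
      MeasureTheory.volume s t := fun s t => Continuous.intervalIntegrable (by fun_prop) _ _
  have hcmem : c ∈ Set.Icc (c - K / q) (c + K / q) := ⟨by linarith, by linarith⟩
  have hf1 : ∀ x ∈ Set.Icc (c - K / q) (c + K / q),
      |f x + q ^ 2 * (x - c)| ≤ q / (1000 * K ^ 2) := by
    intro x hx
    have hd : ∀ y ∈ Set.Icc (c - K / q) (c + K / q),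
        HasDerivWithinAt (fun x => f x + q ^ 2 * (x - c)) (g y + q ^ 2)
          (Set.Icc (c - K / q) (c + K / q)) y := by
      intro y _
      have := (hf y).add (((hasDerivAt_id y).sub_const c).const_mul (q ^ 2))
      simp only [mul_one] at this
      exact this.hasDerivWithinAt
    have := Convex.norm_image_sub_le_of_norm_hasDerivWithin_le hd hgq (convex_Icc _ _) hcmem hx
    simp only [hc, sub_self, mul_zero, add_zero, sub_zero, Real.norm_eq_abs] at this
    have hxc : |x - c| ≤ K / q := abs_le.2 ⟨by linarith [hx.1], by linarith [hx.2]⟩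
    calc _ ≤ q ^ 2 / (1000 * K ^ 3) * |x - c| := this
      _ ≤ q ^ 2 / (1000 * K ^ 3) * (K / q) := by gcongr
      _ = _ := by field_simp
  have hF1 : ∀ x ∈ Set.Icc (c - K / q) (c + K / q),
      |F x - (F c - q ^ 2 * (x - c) ^ 2 / 2)| ≤ 1 / (1000 * K) := by
    intro x hx
    have hd : ∀ y ∈ Set.Icc (c - K / q) (c + K / q),
        HasDerivWithinAt (fun x => F x + q ^ 2 * (x - c) ^ 2 / 2) (f y + q ^ 2 * (y - c))
          (Set.Icc (c - K / q) (c + K / q)) y := by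
      intro y _
      have := (hF y).add (((((hasDerivAt_id y).sub_const c).pow 2).const_mul (q ^ 2)).div_const 2)
      refine HasDerivAt.hasDerivWithinAt (this.congr_deriv ?_)
      simp only [id]
      push_cast
      ring
    have := Convex.norm_image_sub_le_of_norm_hasDerivWithin_le hd hf1 (convex_Icc _ _) hcmem hx
    simp only [Real.norm_eq_abs] at this
    have hxc : |x - c| ≤ K / q := abs_le.2 ⟨by linarith [hx.1], by linarith [hx.2]⟩
    calc _ = |F x + q ^ 2 * (x - c) ^ 2 / 2 - (F c + q ^ 2 * (c - c) ^ 2 / 2)| := by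
          congr 1; ring
      _ ≤ q / (1000 * K ^ 2) * |x - c| := this
      _ ≤ q / (1000 * K ^ 2) * (K / q) := by gcongr
      _ = _ := by field_simp
  have hinner : ‖(∫ x in (c - K / q)..(c + K / q), Complex.exp (Complex.I * (F x : ℂ))) -
      ∫ x in (c - K / q)..(c + K / q),
        Complex.exp (Complex.I * ((F c - q ^ 2 * (x - c) ^ 2 / 2 : ℝ) : ℂ))‖ ≤
      1 / (500 * q) := by
    rw [← intervalIntegral.integral_sub (hint _ _)
      (Continuous.intervalIntegrable (by fun_prop) _ _)]
    have := intervalIntegral.norm_integral_le_of_norm_le_const (a := c - K / q) (b := c + K / q)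
      (C := 1 / (1000 * K))
      (f := fun x => Complex.exp (Complex.I * (F x : ℂ)) -
        Complex.exp (Complex.I * ((F c - q ^ 2 * (x - c) ^ 2 / 2 : ℝ) : ℂ))) (by
        intro x hx
        rw [Set.uIoc_of_le (by linarith)] at hx
        exact (norm_exp_I_mul_sub_exp_I_mul_le _ _).trans
          (hF1 x (Set.Ioc_subset_Icc_self hx)))
    refine this.trans_eq ?_
    rw [abs_of_nonneg (by linarith)]
    field_simp
    ring
  have hanti : AntitoneOn f (Set.Icc a b) := by
    refine antitoneOn_of_deriv_nonpos (convex_Icc a b)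
      (fun x _ => (hf x).continuousAt.continuousWithinAt)
      (fun x _ => (hf x).differentiableAt.differentiableWithinAt) fun x hx => ?_
    rw [(hf x).deriv]
    exact hg0 x (interior_subset hx)
  have hsmall : q / (1000 * K ^ 2) ≤ q * K / 2 := by
    rw [div_le_iff₀ (by positivity)]
    have : (1 : ℝ) ≤ K ^ 3 := one_le_pow₀ (by linarith)
    nlinarith
  have hL : 0 < q * K / 2 := by positivity
  have hqr : q ^ 2 * (K / q) = q * K := by field_simp
  have hleft : ‖∫ x in a..(c - K / q), Complex.exp (Complex.I * (F x : ℂ))‖ ≤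
      4 / (q * K / 2) := by
    refine norm_integral_exp_le_of_concave hF hf hg hac hL
      (fun x hx => hg0 x ⟨hx.1, by linarith [hx.2]⟩) fun x hx => ?_
    have h1 := hanti (a := x) ⟨hx.1, by linarith [hx.2]⟩
      (b := c - K / q) ⟨by linarith, by linarith⟩ hx.2
    have h2 := (abs_le.1 (hf1 (c - K / q) ⟨le_rfl, by linarith⟩)).1
    have h3 : q ^ 2 * (c - K / q - c) = -(q * K) := by rw [← hqr]; ring
    rw [h3] at h2
    exact le_trans (by linarith) (le_abs_self _)
  have hright : ‖∫ x in (c + K / q)..b, Complex.exp (Complex.I * (F x : ℂ))‖ ≤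
      4 / (q * K / 2) := by
    refine norm_integral_exp_le_of_concave hF hf hg hcb hL
      (fun x hx => hg0 x ⟨by linarith [hx.1], hx.2⟩) fun x hx => ?_
    have h1 := hanti (a := c + K / q) ⟨by linarith, by linarith⟩
      (b := x) ⟨by linarith [hx.1], hx.2⟩ hx.1
    have h2 := (abs_le.1 (hf1 (c + K / q) ⟨by linarith, le_rfl⟩)).2
    have h3 : q ^ 2 * (c + K / q - c) = q * K := by rw [← hqr]; ring
    rw [h3] at h2
    exact le_trans (by linarith) (neg_le_abs _)
  have houter : 4 / (q * K / 2) ≤ 1 / (200 * q) := by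
    rw [div_le_div_iff₀ hL (by positivity)]
    nlinarith
  have hmain := norm_integral_exp_quadratic_ge (K := K) (by linarith) hq c (F c)
  rw [← intervalIntegral.integral_add_adjacent_intervals (b := c + K / q) (hint _ _) (hint _ _),
    ← intervalIntegral.integral_add_adjacent_intervals (b := c - K / q) (hint _ _) (hint _ _)]
  set X := ∫ x in a..(c - K / q), Complex.exp (Complex.I * (F x : ℂ))
  set Y := ∫ x in (c - K / q)..(c + K / q), Complex.exp (Complex.I * (F x : ℂ))
  set Z := ∫ x in (c + K / q)..b, Complex.exp (Complex.I * (F x : ℂ))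
  set Q := ∫ x in (c - K / q)..(c + K / q),
    Complex.exp (Complex.I * ((F c - q ^ 2 * (x - c) ^ 2 / 2 : ℝ) : ℂ))
  have htri : ‖Q‖ ≤ ‖X + Y + Z‖ + (‖Y - Q‖ + ‖X‖ + ‖Z‖) := by
    have h : Q = (X + Y + Z) - ((Y - Q) + X + Z) := by ring
    calc ‖Q‖ = ‖(X + Y + Z) - ((Y - Q) + X + Z)‖ := congrArg _ h
      _ ≤ _ := (norm_sub_le _ _).trans (add_le_add_right (norm_add₃_le) _)
  have e1 : 1 / (15 * q) = (1 / 15) * q⁻¹ := by field_simp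
  have e2 : 1 / (30 * q) = (1 / 30) * q⁻¹ := by field_simp
  have e3 : 1 / (200 * q) = (1 / 200) * q⁻¹ := by field_simp
  have e4 : 1 / (500 * q) = (1 / 500) * q⁻¹ := by field_simp
  have hq' := inv_pos.2 hq
  rw [e1] at hmain
  rw [e3] at houter
  rw [e4] at hinner
  rw [e2]
  linarith

/-- The size of the second derivative at a point `c` of order at most `(μ / lam) ^ (1 / (m - 1))`. -/
theorem rpow_mul_rpow_le_inv_sqrt {m μ lam c : ℝ} (hm : 2 ≤ m) (hμ : 0 < μ) (hlam : 0 < lam)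
    (hc : 0 < c) (h : lam * c ^ (m - 1) ≤ μ) :
    μ ^ (-(m - 2) / (2 * m - 2)) * lam ^ (-1 / (2 * m - 2)) ≤ (√(lam * c ^ (m - 2)))⁻¹ := by
  have hm1 : 0 < m - 1 := by linarith
  have hm2 : 0 < 2 * m - 2 := by linarith
  rw [neg_div, neg_div, Real.rpow_neg hμ.le, Real.rpow_neg hlam.le, ← mul_inv]
  refine inv_anti₀ (Real.sqrt_pos.2 (by positivity)) ?_
  refine Real.sqrt_le_iff.2 ⟨by positivity, ?_⟩
  have hcm : c ^ (m - 2) = (c ^ (m - 1)) ^ ((m - 2) / (m - 1)) := by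
    rw [← Real.rpow_mul hc.le]
    congr 1
    field_simp
  have hle : c ^ (m - 2) ≤ (μ / lam) ^ ((m - 2) / (m - 1)) := by
    rw [hcm]
    refine Real.rpow_le_rpow (by positivity) ?_ (div_nonneg (by linarith) hm1.le)
    rw [le_div_iff₀ hlam]
    linarith
  calc lam * c ^ (m - 2) ≤ lam * (μ / lam) ^ ((m - 2) / (m - 1)) := by gcongr
    _ = μ ^ ((m - 2) / (m - 1)) * lam ^ (1 - (m - 2) / (m - 1)) := by
      rw [Real.div_rpow hμ.le hlam.le, Real.rpow_sub hlam, Real.rpow_one]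
      ring
    _ = (μ ^ ((m - 2) / (2 * m - 2)) * lam ^ (1 / (2 * m - 2))) ^ 2 := by
      rw [mul_pow, ← Real.rpow_natCast (μ ^ _), ← Real.rpow_natCast (lam ^ _),
        ← Real.rpow_mul hμ.le, ← Real.rpow_mul hlam.le]
      have hm1' : m - 1 ≠ 0 := hm1.ne'
      have e : 2 * m - 2 = 2 * (m - 1) := by ring
      rw [e]
      congr 2 <;> push_cast <;> field_simp
      ring

/-- Location of the critical point of the phase `μ ξ - lam (ξ ^ m + E ξ)`, where `e` is the
derivative of the perturbation `E`. -/
theorem exists_critical_point {m C₀ μ lam δ κ : ℝ} (hm : 2 ≤ m) (hμ : 0 < μ) (hlam : 0 < lam)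
    (hδ : 0 < δ) (hC : C₀ * δ ≤ 1) (hC₀ : 0 < C₀) (hκ : 0 < κ) (hκδ : κ ≤ δ) {e : ℝ → ℝ}
    (he : Continuous e) (hE : ∀ ξ ∈ Set.Icc (0 : ℝ) δ, |e ξ| ≤ C₀ * ξ ^ m)
    (hsmall : μ < lam * κ ^ (m - 1)) :
    ∃ c, 0 < c ∧ c < κ ∧ μ - lam * (m * c ^ (m - 1) + e c) = 0 ∧
      lam * c ^ (m - 1) ≤ μ ∧ μ ≤ (m + 1) * (lam * c ^ (m - 1)) := by
  have hm1 : 0 < m - 1 := by linarith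
  have he1 : ∀ ξ ∈ Set.Icc (0 : ℝ) δ, |e ξ| ≤ ξ ^ (m - 1) := by
    intro ξ hξ
    have hp : ξ ^ m = ξ ^ (m - 1) * ξ := by
      have := Real.rpow_add_one' hξ.1 (y := m - 1) (by linarith)
      rwa [sub_add_cancel] at this
    have h0 : 0 ≤ ξ ^ (m - 1) := Real.rpow_nonneg hξ.1 _
    have h1 : C₀ * ξ ≤ 1 := (mul_le_mul_of_nonneg_left hξ.2 hC₀.le).trans hC
    calc |e ξ| ≤ C₀ * ξ ^ m := hE ξ hξ
      _ = (C₀ * ξ) * ξ ^ (m - 1) := by rw [hp]; ring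
      _ ≤ 1 * ξ ^ (m - 1) := by gcongr
      _ = _ := one_mul _
  have hcont : Continuous fun x : ℝ => μ - lam * (m * x ^ (m - 1) + e x) := by
    have := Real.continuous_rpow_const hm1.le
    fun_prop
  have hf0 : 0 < μ - lam * (m * (0 : ℝ) ^ (m - 1) + e 0) := by
    have h := hE 0 ⟨le_rfl, hδ.le⟩
    rw [Real.zero_rpow (by linarith), mul_zero] at h
    rw [abs_nonpos_iff.1 h, Real.zero_rpow hm1.ne']
    simpa using hμ
  have hκe := (abs_le.1 (he1 κ ⟨hκ.le, hκδ⟩)).1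
  have hκp : 0 < κ ^ (m - 1) := Real.rpow_pos_of_pos hκ _
  have hfκ : μ - lam * (m * κ ^ (m - 1) + e κ) ≤ 0 := by
    have : κ ^ (m - 1) ≤ m * κ ^ (m - 1) + e κ := by nlinarith
    have := mul_le_mul_of_nonneg_left this hlam.le
    linarith
  obtain ⟨c, hc, hfc⟩ := intermediate_value_Icc' hκ.le hcont.continuousOn ⟨hfκ, hf0.le⟩
  simp only at hfc
  have hc0 : 0 < c := by
    rcases hc.1.eq_or_lt with h | h
    · rw [← h] at hfc
      exact absurd hfc hf0.ne'
    · exact h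
  have hce := abs_le.1 (he1 c ⟨hc.1, hc.2.trans hκδ⟩)
  have hcp : 0 < c ^ (m - 1) := Real.rpow_pos_of_pos hc0 _
  have hle : lam * c ^ (m - 1) ≤ μ := by
    have : c ^ (m - 1) ≤ m * c ^ (m - 1) + e c := by nlinarith
    have := mul_le_mul_of_nonneg_left this hlam.le
    linarith
  refine ⟨c, hc0, ?_, hfc, hle, ?_⟩
  · have : c ^ (m - 1) < κ ^ (m - 1) := lt_of_mul_lt_mul_left (hle.trans_lt hsmall) hlam.le
    exact (Real.rpow_lt_rpow_iff hc0.le hκ.le hm1).1 this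
  · have : m * c ^ (m - 1) + e c ≤ (m + 1) * c ^ (m - 1) := by linarith [hce.2]
    have := mul_le_mul_of_nonneg_left this hlam.le
    linarith

/-- Near `c > 0` the second derivative `m (m - 1) ξ ^ (m - 2) + O(ξ ^ (m - 1))` is almost constant
on the scale of `c`. -/
theorem abs_second_derivative_sub_le {m C₀ ε η c x y : ℝ} (hm : 2 ≤ m) (hC₀ : 0 < C₀)
    (hη : η ≤ 1)
    (hpow : ∀ t : ℝ, |t - 1| ≤ η → |t ^ (m - 2) - 1| ≤ ε / 2) (hc : 0 < c)
    (hcε : C₀ * 2 ^ (m - 1) * c ≤ ε / 2) (hx : |x - c| ≤ η * c) (hy : |y| ≤ C₀ * x ^ (m - 1)) :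
    |m * (m - 1) * (x ^ (m - 2) - c ^ (m - 2)) + y| ≤ m * (m - 1) * c ^ (m - 2) * ε := by
  have hηc : η * c ≤ c := mul_le_of_le_one_left hc.le hη
  obtain ⟨hx1, hx2⟩ := abs_le.1 hx
  have hx0 : 0 ≤ x := by linarith
  have hcp : 0 < c ^ (m - 2) := Real.rpow_pos_of_pos hc _
  have hmm : 1 ≤ m * (m - 1) := by nlinarith
  have hε : 0 ≤ ε / 2 := le_trans (by positivity) hcε
  have h1 : |x ^ (m - 2) - c ^ (m - 2)| ≤ c ^ (m - 2) * (ε / 2) := by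
    have ht : |x / c - 1| ≤ η := by
      rw [div_sub_one hc.ne', abs_div, abs_of_pos hc, div_le_iff₀ hc]
      exact hx
    have he : x ^ (m - 2) - c ^ (m - 2) = c ^ (m - 2) * ((x / c) ^ (m - 2) - 1) := by
      rw [Real.div_rpow hx0 hc.le]
      field_simp
    rw [he, abs_mul, abs_of_pos hcp]
    exact mul_le_mul_of_nonneg_left (hpow _ ht) hcp.le
  have h2 : |y| ≤ c ^ (m - 2) * (ε / 2) := by
    have hp : c ^ (m - 1) = c ^ (m - 2) * c := by
      have := Real.rpow_add_one' hc.le (y := m - 2) (by linarith)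
      rwa [show m - 2 + 1 = m - 1 by ring] at this
    calc |y| ≤ C₀ * x ^ (m - 1) := hy
      _ ≤ C₀ * (2 * c) ^ (m - 1) := by
        gcongr
        · linarith
        · linarith
      _ = c ^ (m - 2) * (C₀ * 2 ^ (m - 1) * c) := by
        rw [Real.mul_rpow (by norm_num) hc.le, hp]
        ring
      _ ≤ _ := by gcongr
  have h3 := abs_add_le (m * (m - 1) * (x ^ (m - 2) - c ^ (m - 2))) y
  rw [abs_mul, abs_of_nonneg (by linarith : 0 ≤ m * (m - 1))] at h3
  have h4 := mul_le_mul_of_nonneg_left h1 (by linarith : 0 ≤ m * (m - 1))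
  have h5 := mul_le_mul_of_nonneg_right hmm (by positivity : 0 ≤ c ^ (m - 2) * (ε / 2))
  linarith

theorem exists_abs_rpow_sub_one_le (p : ℝ) {ε : ℝ} (hε : 0 < ε) :
    ∃ η : ℝ, 0 < η ∧ η ≤ 1 ∧ ∀ t : ℝ, |t - 1| ≤ η → |t ^ p - 1| ≤ ε := by
  have hc : ContinuousAt (fun t : ℝ => t ^ p) 1 :=
    Real.continuousAt_rpow_const 1 p (Or.inl one_ne_zero)
  obtain ⟨η, hη, h⟩ := Metric.continuousAt_iff.1 hc ε hε
  refine ⟨min (η / 2) 1, by positivity, min_le_right _ _, fun t ht => ?_⟩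
  have := h (x := t) (by
    rw [Real.dist_eq]
    have := ht.trans (min_le_left _ _)
    linarith)
  rw [Real.dist_eq, Real.one_rpow] at this
  exact this.le

/-- The critical point is far from the origin on the scale `μ⁻¹`. -/
theorem le_mul_critical_point {m μ lam c B M : ℝ} (hm : 2 ≤ m) (hμ : 0 < μ) (hlam : 0 < lam)
    (hc : 0 < c) (hB : 0 < B) (hM : (m + 1) * B ^ (m - 1) ≤ M) (hMl : M * lam ≤ μ ^ m)
    (h : μ ≤ (m + 1) * (lam * c ^ (m - 1))) : B ≤ μ * c := by
  have hm1 : 0 < m - 1 := by linarith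
  refine (Real.rpow_le_rpow_iff hB.le (by positivity) hm1).1 ?_
  have hp : μ ^ m = μ ^ (m - 1) * μ := by
    have := Real.rpow_add_one' hμ.le (y := m - 1) (by linarith)
    rwa [sub_add_cancel] at this
  rw [Real.mul_rpow hμ.le hc.le]
  have hmp : 0 < (m + 1) * lam := by positivity
  refine le_of_mul_le_mul_left ?_ hmp
  calc (m + 1) * lam * B ^ (m - 1) = ((m + 1) * B ^ (m - 1)) * lam := by ring
    _ ≤ M * lam := by gcongr
    _ ≤ μ ^ (m - 1) * μ := by rw [← hp]; exact hMl
    _ ≤ μ ^ (m - 1) * ((m + 1) * (lam * c ^ (m - 1))) := by gcongr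
    _ = _ := by ring


/-- Lower bound for the oscillatory integral `∫₀^δ e^{i(μξ - λ(ξ^m + O(ξ^{m+1})))} dξ`
in the regime `1 ≪ μ ≪ λ ≪ μ^m`: for `δ > 0` sufficiently small the integral is
bounded below by `C_δ μ^{-(m-2)/(2m-2)} λ^{-1/(2m-2)}`. The error term is any smooth
function `E` with `|E(ξ)| ≤ C₀ ξ^{m+1}`, `|E'(ξ)| ≤ C₀ ξ^m`, `|E''(ξ)| ≤ C₀ ξ^{m-1}`
on `[0, δ]`. -/
theorem stmt_4 (m C₀ : ℝ) (hm : 2 ≤ m) (hC₀ : 0 < C₀) :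
    ∃ δ₀ : ℝ, 0 < δ₀ ∧ ∀ δ : ℝ, 0 < δ → δ ≤ δ₀ →
      ∃ Cδ M : ℝ, 0 < Cδ ∧ 0 < M ∧
        ∀ E : ℝ → ℝ, ContDiff ℝ (⊤ : ℕ∞) E →
          (∀ ξ ∈ Set.Icc (0:ℝ) δ,
            |E ξ| ≤ C₀ * ξ ^ (m + 1) ∧ |deriv E ξ| ≤ C₀ * ξ ^ m ∧
              |deriv (deriv E) ξ| ≤ C₀ * ξ ^ (m - 1)) →
          ∀ μ lam : ℝ, M ≤ μ → M * μ ≤ lam → M * lam ≤ μ ^ m →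
            Cδ * μ ^ (-(m - 2) / (2 * m - 2)) * lam ^ (-1 / (2 * m - 2)) ≤
              ‖∫ ξ in (0:ℝ)..δ,
                Complex.exp (Complex.I * ((μ * ξ - lam * (ξ ^ m + E ξ) : ℝ) : ℂ))‖ := by
  have hm1 : 0 < m - 1 := by linarith
  have hmm : 0 < m * (m - 1) := by positivity
  refine ⟨1 / C₀, by positivity, fun δ hδ hδ₀ => ?_⟩
  have hC : C₀ * δ ≤ 1 := by
    rw [le_div_iff₀ hC₀] at hδ₀
    linarith
  obtain ⟨K, hK⟩ : ∃ K : ℝ, K = 1600 := ⟨_, rfl⟩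
  obtain ⟨ε, hε⟩ : ∃ ε : ℝ, ε = 1 / (1000 * K ^ 3) := ⟨_, rfl⟩
  have hK0 : 0 < K := by rw [hK]; norm_num
  have hε0 : 0 < ε := by rw [hε]; positivity
  obtain ⟨η, hη0, hη1, hη⟩ := exists_abs_rpow_sub_one_le (m - 2) (half_pos hε0)
  obtain ⟨κ, hκ⟩ : ∃ κ : ℝ, κ = min (δ / 2) (ε / 2 / (C₀ * 2 ^ (m - 1))) := ⟨_, rfl⟩
  have hκ0 : 0 < κ := by rw [hκ]; positivity
  have hκδ : κ ≤ δ / 2 := by rw [hκ]; exact min_le_left _ _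
  have hκε : C₀ * 2 ^ (m - 1) * κ ≤ ε / 2 := by
    rw [mul_comm, ← le_div_iff₀ (by positivity), hκ]
    exact min_le_right _ _
  have hκp : 0 < κ ^ (m - 1) := Real.rpow_pos_of_pos hκ0 _
  refine ⟨1 / (30 * √(m * (m - 1))),
    2 / κ ^ (m - 1) + (m + 1) * (2 * K ^ 2 / η ^ 2) ^ (m - 1), by positivity, by positivity, ?_⟩
  intro E hE hbound μ lam hMμ hMl hMm
  have hB : 0 < 2 * K ^ 2 / η ^ 2 := by positivity
  have hBp : 0 < (m + 1) * (2 * K ^ 2 / η ^ 2) ^ (m - 1) := by positivity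
  have hκM : 0 < 2 / κ ^ (m - 1) := by positivity
  have hμ : 0 < μ := by linarith
  have hlam : 0 < lam := lt_of_lt_of_le (by positivity) hMl
  have hsmall : μ < lam * κ ^ (m - 1) := by
    have h1 : 2 / κ ^ (m - 1) * μ ≤ lam := le_trans (by gcongr; linarith) hMl
    have h2 := mul_le_mul_of_nonneg_right h1 hκp.le
    have h3 : 2 / κ ^ (m - 1) * μ * κ ^ (m - 1) = 2 * μ := by field_simp
    linarith
  have hE1 : ContDiff ℝ (⊤ : ℕ∞) (deriv E) := (contDiff_infty_iff_deriv.1 hE).2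
  have hE2 : ContDiff ℝ (⊤ : ℕ∞) (deriv (deriv E)) := (contDiff_infty_iff_deriv.1 hE1).2
  obtain ⟨c, hc0, hcκ, hfc, hcμ, hμc⟩ := exists_critical_point hm hμ hlam hδ hC hC₀ hκ0
    (by linarith) hE1.continuous (fun ξ hξ => (hbound ξ hξ).2.1) hsmall
  have hBc : 2 * K ^ 2 / η ^ 2 ≤ μ * c :=
    le_mul_critical_point hm hμ hlam hc0 hB (by linarith) hMm hμc
  have hcp : 0 < c ^ (m - 2) := Real.rpow_pos_of_pos hc0 _
  obtain ⟨q, hq⟩ : ∃ q, q = √(m * (m - 1)) * √(lam * c ^ (m - 2)) := ⟨_, rfl⟩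
  have hq0 : 0 < q := by rw [hq]; positivity
  have hq2 : q ^ 2 = m * (m - 1) * (lam * c ^ (m - 2)) := by
    rw [hq, mul_pow, Real.sq_sqrt hmm.le, Real.sq_sqrt (by positivity)]
  have hpc : c ^ (m - 1) = c ^ (m - 2) * c := by
    have := Real.rpow_add_one' hc0.le (y := m - 2) (by linarith)
    rwa [show m - 2 + 1 = m - 1 by ring] at this
  have hKq : K / q ≤ η * c := by
    rw [div_le_iff₀ hq0]
    refine le_of_sq_le_sq ?_ (by positivity)
    rw [div_le_iff₀ (by positivity)] at hBc
    have h1 : μ ≤ 2 * (m * (m - 1)) * (lam * c ^ (m - 1)) := by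
      refine hμc.trans ?_
      gcongr
      nlinarith
    calc K ^ 2 ≤ η ^ 2 * c * (μ / 2) := by linarith
      _ ≤ η ^ 2 * c * (2 * (m * (m - 1)) * (lam * c ^ (m - 1)) / 2) := by gcongr
      _ = (η * c * q) ^ 2 := by rw [mul_pow, hq2, hpc]; ring
  have hηc : η * c ≤ c := mul_le_of_le_one_left hc0.le hη1
  have hF : ∀ x, HasDerivAt (fun ξ : ℝ => μ * ξ - lam * (ξ ^ m + E ξ))
      (μ - lam * (m * x ^ (m - 1) + deriv E x)) x := by
    intro x
    have hEx := (hE.differentiable (by simp) x).hasDerivAt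
    have := ((hasDerivAt_id x).const_mul μ).sub
      (((Real.hasDerivAt_rpow_const (x := x) (p := m) (Or.inr (by linarith))).add hEx).const_mul lam)
    exact this.congr_deriv (by rw [mul_one])
  have hf : ∀ x, HasDerivAt (fun ξ : ℝ => μ - lam * (m * ξ ^ (m - 1) + deriv E ξ))
      (-(lam * (m * (m - 1) * x ^ (m - 2) + deriv (deriv E) x))) x := by
    intro x
    have hEx := (hE1.differentiable (by simp) x).hasDerivAt
    have := ((((Real.hasDerivAt_rpow_const (x := x) (p := m - 1)
      (Or.inr (by linarith))).const_mul m).add hEx).const_mul lam).const_sub μ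
    refine this.congr_deriv ?_
    rw [show m - 1 - 1 = m - 2 by ring]
    ring
  have hg : Continuous fun x : ℝ => -(lam * (m * (m - 1) * x ^ (m - 2) + deriv (deriv E) x)) := by
    have h1 := Real.continuous_rpow_const (q := m - 2) (by linarith)
    have h2 := hE2.continuous
    fun_prop
  have hmain := norm_integral_exp_ge_of_concave hF hf hg (a := 0) (b := δ) (c := c) (q := q)
    (K := K) hK.ge hq0 (by linarith) (by linarith) hfc ?_ ?_
  · refine le_trans ?_ hmain
    have h := rpow_mul_rpow_le_inv_sqrt hm hμ hlam hc0 hcμ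
    calc _ = 1 / (30 * √(m * (m - 1))) *
          (μ ^ (-(m - 2) / (2 * m - 2)) * lam ^ (-1 / (2 * m - 2))) := by ring
      _ ≤ 1 / (30 * √(m * (m - 1))) * (√(lam * c ^ (m - 2)))⁻¹ := by gcongr
      _ = 1 / (30 * q) := by
        rw [hq, one_div, one_div, ← mul_inv, mul_assoc]
  · intro x hx
    have hp : x ^ (m - 1) = x ^ (m - 2) * x := by
      have := Real.rpow_add_one' hx.1 (y := m - 2) (by linarith)
      rwa [show m - 2 + 1 = m - 1 by ring] at this
    have hx2 : 0 ≤ x ^ (m - 2) := Real.rpow_nonneg hx.1 _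
    have h1 : C₀ * x ≤ 1 := (mul_le_mul_of_nonneg_left hx.2 hC₀.le).trans hC
    have h2 := (abs_le.1 (hbound x hx).2.2).1
    have h3 : C₀ * x ^ (m - 1) ≤ x ^ (m - 2) := by
      calc _ = C₀ * x * x ^ (m - 2) := by rw [hp]; ring
        _ ≤ 1 * x ^ (m - 2) := by gcongr
        _ = _ := one_mul _
    have h4 : x ^ (m - 2) ≤ m * (m - 1) * x ^ (m - 2) :=
      le_mul_of_one_le_left hx2 (by nlinarith)
    exact neg_nonpos.2 (mul_nonneg hlam.le (by linarith))
  · intro x hx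
    have hxc : |x - c| ≤ η * c := abs_le.2 ⟨by linarith [hx.1], by linarith [hx.2]⟩
    have h := abs_second_derivative_sub_le hm hC₀ hη1 hη hc0
      (le_trans (by gcongr) hκε) hxc
      (hbound x ⟨by linarith [hx.1], by linarith [hx.2]⟩).2.2
    have he : -(lam * (m * (m - 1) * x ^ (m - 2) + deriv (deriv E) x)) + q ^ 2 =
        -(lam * (m * (m - 1) * (x ^ (m - 2) - c ^ (m - 2)) + deriv (deriv E) x)) := by
      rw [hq2]; ring
    rw [he, abs_neg, abs_mul, abs_of_pos hlam]
    calc _ ≤ lam * (m * (m - 1) * c ^ (m - 2) * ε) := by gcongr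
      _ = q ^ 2 / (1000 * K ^ 3) := by rw [hq2, hε]; ring
end

section
/- Let φ(ξ₁,ξ₂) = ξ₁^{m₁} + ξ₂^{m₂} on (0,1)² with m₁,m₂ ≥ 2, h defined by 1/h = 1/m₁ + 1/m₂, and let dν be the pushforward of Lebesgue measure on (0,1)² under ξ ↦ (ξ, φ(ξ)). If the adjoint restriction operator R* f = (f dν)^∧ is bounded from L^∞ to L^p(ℝ³) for some p, then necessarily p > h + 1. More precisely, ‖(dν)^∧‖_{L^p(ℝ³)}^p ≳ ∫₁^∞ x₃^{−(p−1)/h} dx₃, which is infinite when (p−1)/h ≤ 1. -/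
open MeasureTheory

/-- The Fourier transform of the measure `dν` on the graph of
`φ(ξ) = ξ₁^{m₁} + ξ₂^{m₂}` over `(0,1)²`. -/
noncomputable def nuHat (m₁ m₂ : ℝ) (x : ℝ × ℝ × ℝ) : ℂ :=
  ∫ ξ in (Set.Ioo (0:ℝ) 1) ×ˢ (Set.Ioo (0:ℝ) 1),
    Complex.exp (-Complex.I *
      ((x.1 * ξ.1 + x.2.1 * ξ.2 + x.2.2 * (ξ.1 ^ m₁ + ξ.2 ^ m₂) : ℝ) : ℂ))

/-- A lower bound, uniform in the upper endpoint and in the slope, for the sine integral with the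
convex phase `y * s + s ^ m`. -/
lemma le_integral_sin_phase {m y T : ℝ} (hm : 2 ≤ m) (hy0 : 0 ≤ y) (hy : y ≤ 1 / 100)
    (hT : 1 ≤ T) :
    1 / (30 * m) ≤ ∫ s in (0:ℝ)..T, Real.sin (y * s + s ^ m) := by
  have hcψ : Continuous fun s : ℝ => y * s + s ^ m :=
    (continuous_const.mul continuous_id).add (Real.continuous_rpow_const (by linarith))
  have hcs : Continuous fun s : ℝ => Real.sin (y * s + s ^ m) := Real.continuous_sin.comp hcψ
  set G : ℝ → ℝ := fun T => (∫ s in (0:ℝ)..T, Real.sin (y * s + s ^ m)) -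
    (1 - Real.cos (y * T + T ^ m)) / (y + m * T ^ (m - 1)) with hG
  have hψ'pos : ∀ s : ℝ, 0 < s → 0 < y + m * s ^ (m - 1) := fun s hs => by
    have := Real.rpow_pos_of_pos hs (m - 1)
    positivity
  have hderiv : ∀ s : ℝ, 0 < s → HasDerivAt G
      ((1 - Real.cos (y * s + s ^ m)) * (m * ((m - 1) * s ^ (m - 2))) /
        (y + m * s ^ (m - 1)) ^ 2) s := by
    intro s hs
    have h1 : HasDerivAt (fun T => ∫ s in (0:ℝ)..T, Real.sin (y * s + s ^ m))
        (Real.sin (y * s + s ^ m)) s :=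
      intervalIntegral.integral_hasDerivAt_right (hcs.intervalIntegrable _ _)
        (hcs.stronglyMeasurableAtFilter _ _) hcs.continuousAt
    have hψ : HasDerivAt (fun s : ℝ => y * s + s ^ m) (y + m * s ^ (m - 1)) s := by
      exact (((hasDerivAt_id' s).const_mul y).add
        (Real.hasDerivAt_rpow_const (p := m) (Or.inl hs.ne'))).congr_deriv (by rw [mul_one])
    have hψ' : HasDerivAt (fun s : ℝ => y + m * s ^ (m - 1)) (m * ((m - 1) * s ^ (m - 2))) s := by
      have := ((Real.hasDerivAt_rpow_const (x := s) (p := m - 1) (Or.inl hs.ne')).const_mul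
        m).const_add y
      rwa [show m - 1 - 1 = m - 2 by ring] at this
    have hne := (hψ'pos s hs).ne'
    refine (h1.sub ((hψ.cos.const_sub 1).div hψ' hne)).congr_deriv ?_
    field_simp
    ring
  have hmono : MonotoneOn G (Set.Ici 1) := by
    refine monotoneOn_of_deriv_nonneg (convex_Ici 1)
      (fun s hs => (hderiv s (zero_lt_one.trans_le hs)).continuousAt.continuousWithinAt)
      (fun s hs => ?_) (fun s hs => ?_)
    all_goals
      rw [interior_Ici] at hs
      have hs0 : 0 < s := zero_lt_one.trans hs
    · exact (hderiv s hs0).differentiableAt.differentiableWithinAt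
    · rw [(hderiv s hs0).deriv]
      have h1 := Real.rpow_nonneg hs0.le (m - 2)
      have h2 : 0 ≤ 1 - Real.cos (y * s + s ^ m) := by linarith [Real.cos_le_one (y * s + s ^ m)]
      have h3 : 0 ≤ m - 1 := by linarith
      positivity
  have hGT : G T ≤ ∫ s in (0:ℝ)..T, Real.sin (y * s + s ^ m) := by
    have h2 : 0 ≤ 1 - Real.cos (y * T + T ^ m) := by linarith [Real.cos_le_one (y * T + T ^ m)]
    have := div_nonneg h2 (hψ'pos T (by linarith)).le
    simp only [hG]
    linarith
  have hsin : (41 / 50 : ℝ) * (1 / (m + 1)) ≤ ∫ s in (0:ℝ)..1, Real.sin (y * s + s ^ m) := by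
    have h1 : ∫ s in (0:ℝ)..1, (41 / 50 : ℝ) * s ^ m = (41 / 50 : ℝ) * (1 / (m + 1)) := by
      rw [intervalIntegral.integral_const_mul, integral_rpow (Or.inl (by linarith))]
      simp [Real.zero_rpow (by linarith : m + 1 ≠ 0)]
    rw [← h1]
    refine intervalIntegral.integral_mono_on zero_le_one
      ((continuous_const.mul (Real.continuous_rpow_const (by linarith))).intervalIntegrable _ _)
      (hcs.intervalIntegrable _ _) (fun s hs => ?_)
    have hsm : s ^ m ≤ 1 := Real.rpow_le_one hs.1 hs.2 (by linarith)
    have hsm0 : 0 ≤ s ^ m := Real.rpow_nonneg hs.1 m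
    have hys0 : 0 ≤ y * s := mul_nonneg hy0 hs.1
    have hys : y * s ≤ 1 / 100 := (mul_le_of_le_one_right hy0 hs.2).trans hy
    have hψ0 : 0 ≤ y * s + s ^ m := by positivity
    have hle : s ^ m ≤ y * s + s ^ m := by linarith
    have hψ1 : y * s + s ^ m ≤ 101 / 100 := by linarith
    generalize y * s + s ^ m = u at *
    have hs3 : u - u ^ 3 / 6 ≤ Real.sin u := Real.sin_ge_sub_cube hψ0
    nlinarith [mul_nonneg hψ0 (mul_nonneg (sub_nonneg.2 hψ1) (by linarith : 0 ≤ 101 / 100 + u))]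
  have hcos : (1 - Real.cos (y * 1 + (1:ℝ) ^ m)) / (y + m * (1:ℝ) ^ (m - 1)) ≤
      (511 / 1000 : ℝ) * (1 / m) := by
    rw [Real.one_rpow, Real.one_rpow, mul_one, mul_one, mul_one_div]
    have hc := Real.one_sub_sq_div_two_le_cos (x := y + 1)
    exact div_le_div₀ (by norm_num) (by nlinarith) (by linarith) (by linarith)
  have hfrac : 1 / (30 * m) ≤ (41 / 50 : ℝ) * (1 / (m + 1)) - (511 / 1000 : ℝ) * (1 / m) := by
    have hm0 : 0 < m := by linarith
    have : (2 / 3 : ℝ) * (1 / m) ≤ 1 / (m + 1) := by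
      rw [mul_one_div, div_le_div_iff₀ hm0 (by linarith)]
      linarith
    have h30 : 1 / (30 * m) = 1 / 30 * (1 / m) := by field_simp
    have := one_div_pos.2 hm0
    rw [h30]
    linarith
  have hG1 : G 1 ≤ G T := hmono Set.self_mem_Ici hT hT
  simp only [hG] at hG1 hGT
  linarith

/-- The one-dimensional lower bound for the oscillatory integral with phase `x * ξ + t * ξ ^ m`,
for frequencies `x` small compared with `t ^ (1 / m)`. -/
lemma le_norm_integral_exp_phase {m x t : ℝ} (hm : 2 ≤ m) (ht : 1 ≤ t) (hx0 : 0 ≤ x)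
    (hx : x ≤ t ^ (1 / m) / 100) :
    1 / (30 * m) * t ^ (-(1 / m)) ≤
      ‖∫ ξ in Set.Ioo (0:ℝ) 1, Complex.exp (-Complex.I * ((x * ξ + t * ξ ^ m : ℝ) : ℂ))‖ := by
  have ht0 : 0 < t := by linarith
  have hm0 : m ≠ 0 := by linarith
  set b : ℝ := t ^ (1 / m) with hb
  have hb0 : 0 < b := Real.rpow_pos_of_pos ht0 _
  have hb1 : 1 ≤ b := Real.one_le_rpow ht (by positivity)
  have hbm : b ^ m = t := by
    rw [hb, ← Real.rpow_mul ht0.le, one_div_mul_cancel hm0, Real.rpow_one]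
  have hcψ : Continuous fun ξ : ℝ => x * ξ + t * ξ ^ m :=
    (continuous_const.mul continuous_id).add
      (continuous_const.mul (Real.continuous_rpow_const (by linarith)))
  have hce : Continuous fun ξ : ℝ =>
      Complex.exp (-Complex.I * ((x * ξ + t * ξ ^ m : ℝ) : ℂ)) := by
    fun_prop
  have hinte : IntegrableOn (fun ξ : ℝ =>
      Complex.exp (-Complex.I * ((x * ξ + t * ξ ^ m : ℝ) : ℂ))) (Set.Ioo 0 1) :=
    (hce.integrableOn_Icc (a := 0) (b := 1)).mono_set Set.Ioo_subset_Icc_self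
  have him : (∫ ξ in Set.Ioo (0:ℝ) 1,
      Complex.exp (-Complex.I * ((x * ξ + t * ξ ^ m : ℝ) : ℂ))).im =
      -∫ ξ in (0:ℝ)..1, Real.sin (x * ξ + t * ξ ^ m) := by
    have h1 := Complex.imCLM.integral_comp_comm hinte
    simp only [Complex.imCLM_apply] at h1
    rw [← h1, intervalIntegral.integral_of_le zero_le_one, integral_Ioc_eq_integral_Ioo,
      ← integral_neg]
    congr 1 with ξ
    rw [show -Complex.I * ((x * ξ + t * ξ ^ m : ℝ) : ℂ)
      = ((-(x * ξ + t * ξ ^ m) : ℝ) : ℂ) * Complex.I by push_cast; ring,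
      Complex.exp_ofReal_mul_I_im, Real.sin_neg]
  have hscale : ∫ ξ in (0:ℝ)..1, Real.sin (x * ξ + t * ξ ^ m) =
      b⁻¹ * ∫ s in (0:ℝ)..b, Real.sin (x / b * s + s ^ m) := by
    have h1 := intervalIntegral.integral_comp_mul_left (a := 0) (b := 1)
      (fun s : ℝ => Real.sin (x / b * s + s ^ m)) hb0.ne'
    rw [mul_zero, mul_one, smul_eq_mul] at h1
    rw [← h1]
    refine intervalIntegral.integral_congr fun ξ hξ => ?_
    rw [Set.uIcc_of_le zero_le_one] at hξ
    rw [Real.mul_rpow hb0.le hξ.1, hbm]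
    congr 2
    field_simp
  have hmain := le_integral_sin_phase hm (div_nonneg hx0 hb0.le)
    (by rw [div_le_iff₀ hb0]; linarith) hb1
  refine le_trans ?_ (Complex.abs_im_le_norm _)
  rw [him, abs_neg, hscale, Real.rpow_neg ht0.le, ← hb, mul_comm]
  exact (mul_le_mul_of_nonneg_left hmain (by positivity)).trans (le_abs_self _)

lemma nuHat_eq_mul (m₁ m₂ : ℝ) (x : ℝ × ℝ × ℝ) :
    nuHat m₁ m₂ x =
      (∫ ξ in Set.Ioo (0:ℝ) 1, Complex.exp (-Complex.I * ((x.1 * ξ + x.2.2 * ξ ^ m₁ : ℝ) : ℂ))) *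
      ∫ ξ in Set.Ioo (0:ℝ) 1,
        Complex.exp (-Complex.I * ((x.2.1 * ξ + x.2.2 * ξ ^ m₂ : ℝ) : ℂ)) := by
  rw [nuHat, Measure.volume_eq_prod, ← setIntegral_prod_mul]
  congr 1 with ξ
  rw [← Complex.exp_add]
  congr 1
  push_cast
  ring

/-- Pointwise lower bound for `nuHat` on the region carrying the divergence. -/
lemma le_norm_nuHat {m₁ m₂ x₁ x₂ t : ℝ} (hm₁ : 2 ≤ m₁) (hm₂ : 2 ≤ m₂) (ht : 1 ≤ t)
    (hx₁0 : 0 ≤ x₁) (hx₁ : x₁ ≤ t ^ (1 / m₁) / 100)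
    (hx₂0 : 0 ≤ x₂) (hx₂ : x₂ ≤ t ^ (1 / m₂) / 100) :
    1 / (30 * m₁) * (1 / (30 * m₂)) * t ^ (-(1 / m₁ + 1 / m₂)) ≤ ‖nuHat m₁ m₂ (x₁, x₂, t)‖ := by
  have ht0 : 0 < t := by linarith
  rw [nuHat_eq_mul, norm_mul, neg_add, Real.rpow_add ht0, mul_mul_mul_comm]
  exact mul_le_mul (le_norm_integral_exp_phase hm₁ ht hx₁0 hx₁)
    (le_norm_integral_exp_phase hm₂ ht hx₂0 hx₂) (by positivity) (norm_nonneg _)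

/-- Integrating a function bounded below by `K t` on boxes of sides `a t`, `b t` over `t > 1`. -/
lemma lintegral_boxes_le {f : ℝ × ℝ × ℝ → ENNReal} {K : ℝ → ENNReal} {a b : ℝ → ℝ}
    (hK : Measurable K) (ha : Measurable a) (hb : Measurable b)
    (hf : ∀ x₁ x₂ t : ℝ, 1 < t → x₁ ∈ Set.Ioo 0 (a t) → x₂ ∈ Set.Ioo 0 (b t) →
      K t ≤ f (x₁, x₂, t)) :
    ∫⁻ t in Set.Ioi (1:ℝ), K t * (ENNReal.ofReal (a t) * ENNReal.ofReal (b t)) ≤ ∫⁻ x, f x := by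
  set S : Set ((ℝ × ℝ) × ℝ) :=
    {z | 1 < z.2 ∧ (0 < z.1.1 ∧ z.1.1 < a z.2) ∧ 0 < z.1.2 ∧ z.1.2 < b z.2} with hS
  have hSm : MeasurableSet S := by
    have ha' : Measurable fun z : (ℝ × ℝ) × ℝ => a z.2 := ha.comp measurable_snd
    have hb' : Measurable fun z : (ℝ × ℝ) × ℝ => b z.2 := hb.comp measurable_snd
    have h₁ : Measurable fun z : (ℝ × ℝ) × ℝ => z.1.1 := by fun_prop
    have h₂ : Measurable fun z : (ℝ × ℝ) × ℝ => z.1.2 := by fun_prop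
    exact (measurableSet_lt measurable_const measurable_snd).inter
      (((measurableSet_lt measurable_const h₁).inter (measurableSet_lt h₁ ha')).inter
        ((measurableSet_lt measurable_const h₂).inter (measurableSet_lt h₂ hb')))
  have hgm : Measurable (S.indicator fun z => K z.2) :=
    (hK.comp measurable_snd).indicator hSm
  have hpres : ∫⁻ z : (ℝ × ℝ) × ℝ, f (z.1.1, z.1.2, z.2) = ∫⁻ x, f x :=
    (volume_preserving_prodAssoc (α₁ := ℝ) (β₁ := ℝ) (γ₁ := ℝ)).lintegral_comp_emb
      MeasurableEquiv.prodAssoc.measurableEmbedding f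
  rw [← hpres]
  calc ∫⁻ t in Set.Ioi (1:ℝ), K t * (ENNReal.ofReal (a t) * ENNReal.ofReal (b t))
      = ∫⁻ t, ∫⁻ w : ℝ × ℝ, S.indicator (fun z => K z.2) (w, t) := by
        rw [← lintegral_indicator measurableSet_Ioi]
        congr 1 with t
        by_cases ht : 1 < t
        · have hbox : (fun w : ℝ × ℝ => S.indicator (fun z => K z.2) (w, t)) =
              (Set.Ioo 0 (a t) ×ˢ Set.Ioo 0 (b t)).indicator fun _ => K t := by
            ext w
            simp [Set.indicator_apply, hS, ht]
          rw [hbox, lintegral_indicator (measurableSet_Ioo.prod measurableSet_Ioo),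
            setLIntegral_const, Measure.volume_eq_prod, Measure.prod_prod]
          simp [ht]
        · simp [hS, ht]
    _ = ∫⁻ z : (ℝ × ℝ) × ℝ, S.indicator (fun z => K z.2) z := by
        exact (lintegral_prod_symm _ hgm.aemeasurable).symm
    _ ≤ ∫⁻ z : (ℝ × ℝ) × ℝ, f (z.1.1, z.1.2, z.2) := by
        refine lintegral_mono (Set.indicator_le fun z hz => ?_)
        exact hf _ _ _ hz.1 hz.2.1 hz.2.2

/-- Necessity of `p > h + 1`: with `1/h = 1/m₁ + 1/m₂`, one has
`‖(dν)^∧‖_{L^p}^p ≳ ∫₁^∞ x₃^{-(p-1)/h} dx₃`; in particular if `(dν)^∧ ∈ L^p(ℝ³)`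
(as follows from `L^∞ → L^p` boundedness of the adjoint restriction operator applied
to `f = 1`), then necessarily `p > h + 1`. -/
theorem stmt_5 (m₁ m₂ h p : ℝ) (hm₁ : 2 ≤ m₁) (hm₂ : 2 ≤ m₂)
    (hh : 1 / h = 1 / m₁ + 1 / m₂) (hp : 1 ≤ p) :
    (∃ c : ℝ, 0 < c ∧
      ENNReal.ofReal c * ∫⁻ t in Set.Ioi (1:ℝ), ENNReal.ofReal (t ^ (-(p - 1) / h)) ≤
        ∫⁻ x : ℝ × ℝ × ℝ, ENNReal.ofReal (‖nuHat m₁ m₂ x‖ ^ p)) ∧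
    (Integrable (fun x : ℝ × ℝ × ℝ => ‖nuHat m₁ m₂ x‖ ^ p) → p > h + 1) := by
  have hm₁0 : 0 < m₁ := by linarith
  have hm₂0 : 0 < m₂ := by linarith
  have hh0 : 0 < h := one_div_pos.1 (hh ▸ by positivity)
  have hlower : ∃ c : ℝ, 0 < c ∧
      ENNReal.ofReal c * ∫⁻ t in Set.Ioi (1:ℝ), ENNReal.ofReal (t ^ (-(p - 1) / h)) ≤
        ∫⁻ x : ℝ × ℝ × ℝ, ENNReal.ofReal (‖nuHat m₁ m₂ x‖ ^ p) := by
    set C : ℝ := 1 / (30 * m₁) * (1 / (30 * m₂)) with hC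
    have hC0 : 0 < C := by positivity
    refine ⟨C ^ p / 10000, by positivity, ?_⟩
    refine le_trans (le_of_eq ?_) (lintegral_boxes_le
      (K := fun t => ENNReal.ofReal ((C * t ^ (-(1 / h))) ^ p))
      (a := fun t => t ^ (1 / m₁) / 100) (b := fun t => t ^ (1 / m₂) / 100)
      (by fun_prop) (by fun_prop) (by fun_prop) fun x₁ x₂ t ht hx₁ hx₂ => ?_)
    · rw [← lintegral_const_mul _ (by fun_prop)]
      refine setLIntegral_congr_fun measurableSet_Ioi fun t ht => ?_
      have ht0 : 0 < t := zero_lt_one.trans ht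
      rw [← ENNReal.ofReal_mul (by positivity), ← ENNReal.ofReal_mul (by positivity),
        ← ENNReal.ofReal_mul (by positivity), Real.mul_rpow hC0.le (by positivity),
        ← Real.rpow_mul ht0.le]
      have hexp : t ^ (-(p - 1) / h) = t ^ (-(1 / h) * p) * (t ^ (1 / m₁) * t ^ (1 / m₂)) := by
        rw [← Real.rpow_add ht0, ← Real.rpow_add ht0, ← hh]
        congr 1
        ring
      rw [hexp]
      congr 1
      ring
    · refine ENNReal.ofReal_le_ofReal (Real.rpow_le_rpow
        (mul_nonneg hC0.le (Real.rpow_nonneg (by linarith) _)) ?_ (by linarith))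
      rw [hh]
      exact le_norm_nuHat hm₁ hm₂ ht.le hx₁.1.le hx₁.2.le hx₂.1.le hx₂.2.le
  refine ⟨hlower, fun hint => ?_⟩
  obtain ⟨c, hc, hle⟩ := hlower
  have hfin : ∫⁻ t in Set.Ioi (1:ℝ), ENNReal.ofReal (t ^ (-(p - 1) / h)) < ⊤ := by
    have hprod := hle.trans_lt hint.lintegral_lt_top
    exact ENNReal.lt_top_of_mul_ne_top_right hprod.ne (ENNReal.ofReal_pos.2 hc).ne'
  have hon : IntegrableOn (fun t : ℝ => t ^ (-(p - 1) / h)) (Set.Ioi 1) := by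
    refine ⟨Measurable.aestronglyMeasurable (by fun_prop), ?_⟩
    rwa [hasFiniteIntegral_iff_ofReal ((ae_restrict_iff' measurableSet_Ioi).2
      (Filter.Eventually.of_forall fun t ht =>
        Real.rpow_nonneg (zero_le_one.trans (le_of_lt ht)) _))]
  have hlt := (integrableOn_Ioi_rpow_iff zero_lt_one).1 hon
  rw [div_lt_iff₀ hh0] at hlt
  linarith
end
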